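/- arXiv:math/0410040 — 7 statements merged into one kernel-verified Lean document; each statement's English description precedes it below -/
import Mathlib

section
/- No eigenvalue of φ is real; that is, the characteristic polynomial of φ has no real root. -/
open scoped TensorProduct

noncomputable section

namespace VoisinPaper
/-- The canonical map `V → ℂ ⊗_ℚ V`, `v ↦ 1 ⊗ v`. -/
def iotaV (V : Type) [AddCommGroup V] [Module ℚ V] : V →ₗ[ℚ] ℂ ⊗[ℚ] V :=
  TensorProduct.mk ℚ ℂ V 1

/-- The conjugation of `ℂ ⊗_ℚ V`: the `ℂ`-antilinear involution fixing `1 ⊗ V`. -/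
def conjV (V : Type) [AddCommGroup V] [Module ℚ V] : ℂ ⊗[ℚ] V →ₗ[ℚ] ℂ ⊗[ℚ] V :=
  TensorProduct.map ((Complex.conjAe.toLinearMap).restrictScalars ℚ) LinearMap.id

/-- The image `c(W)` of a subspace `W ⊆ ℂ ⊗_ℚ V` under the conjugation. -/
def conjSub (V : Type) [AddCommGroup V] [Module ℚ V] (W : Submodule ℂ (ℂ ⊗[ℚ] V)) :
    Submodule ℚ (ℂ ⊗[ℚ] V) :=
  Submodule.map (conjV V) (W.restrictScalars ℚ)

theorem conjV_conjV (V : Type) [AddCommGroup V] [Module ℚ V] (z : ℂ ⊗[ℚ] V) :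
    conjV V (conjV V z) = z := by
  induction z with
  | zero => simp
  | tmul a v => simp [conjV]
  | add a b ha hb => simp [ha, hb]

theorem conjV_smul (V : Type) [AddCommGroup V] [Module ℚ V] (x : ℝ) (z : ℂ ⊗[ℚ] V) :
    conjV V ((x : ℂ) • z) = (x : ℂ) • conjV V z := by
  induction z with
  | zero => simp
  | tmul a v => simp [conjV, TensorProduct.smul_tmul']
  | add a b ha hb => simp only [smul_add, map_add, ha, hb]

theorem conjV_baseChange (V : Type) [AddCommGroup V] [Module ℚ V] (φ : V →ₗ[ℚ] V)
    (z : ℂ ⊗[ℚ] V) :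
    conjV V (LinearMap.baseChange ℂ φ z) = LinearMap.baseChange ℂ φ (conjV V z) := by
  induction z with
  | zero => simp
  | tmul a v => simp [conjV]
  | add a b ha hb => simp only [map_add, ha, hb]

theorem rootMult_le (p : Polynomial ℂ) (m : ℕ) (hp : p ≠ 0) (hd : p.natDegree = m)
    (lam : Fin m → ℂ) (hinj : Function.Injective lam) (hr : ∀ i, p.IsRoot (lam i)) (x : ℂ) :
    p.rootMultiplicity x ≤ 1 := by
  classical
  have hle : (Finset.univ.image lam).val ≤ p.roots := by
    rw [Finset.val_le_iff_val_subset]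
    intro a ha
    have : a ∈ Finset.univ.image lam := ha
    obtain ⟨i, -, rfl⟩ := Finset.mem_image.1 this
    exact (Polynomial.mem_roots hp).2 (hr i)
  have hcard : p.roots.card ≤ (Finset.univ.image lam).val.card := by
    rw [Finset.card_val, Finset.card_image_of_injective _ hinj, Finset.card_fin, ← hd]
    exact p.card_roots'
  have he := Multiset.eq_of_le_of_card_le hle hcard
  rw [← Polynomial.count_roots, ← he]
  exact Multiset.nodup_iff_count_le_one.1 (Finset.nodup _) x

/-- Let `V` be a `ℚ`-vector space of dimension `2n` (`n ≥ 1`) and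
`φ : V → V` a `ℚ`-linear endomorphism whose characteristic polynomial has `2n` distinct complex
roots. Assume `W ⊆ ℂ ⊗ V` is an `n`-dimensional complex subspace, invariant under the
complexification of `φ`, with `ℂ ⊗ V = W ⊕ c(W)` (`c` the conjugation). Then no eigenvalue of
`φ` is real: the characteristic polynomial of `φ` has no real root. -/
theorem no_real_eigenvalue
    (n : ℕ) (hn : 1 ≤ n)
    (V : Type) [AddCommGroup V] [Module ℚ V] [FiniteDimensional ℚ V]
    (hdim : Module.finrank ℚ V = 2 * n)
    (φ : V →ₗ[ℚ] V)
    (lam : Fin (2 * n) → ℂ) (hinj : Function.Injective lam)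
    (hroot : ∀ i, Polynomial.aeval (lam i) (LinearMap.charpoly φ) = 0)
    (W : Submodule ℂ (ℂ ⊗[ℚ] V))
    (hWdim : Module.finrank ℂ W = n)
    (hWinv : ∀ x ∈ W, LinearMap.baseChange ℂ φ x ∈ W)
    (hWsup : W.restrictScalars ℚ ⊔ conjSub V W = ⊤)
    (hWinf : W.restrictScalars ℚ ⊓ conjSub V W = ⊥) :
    ∀ x : ℝ, Polynomial.aeval x (LinearMap.charpoly φ) ≠ 0 := by
  intro x hx
  set f : Module.End ℂ (ℂ ⊗[ℚ] V) := LinearMap.baseChange ℂ φ with hf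
  have hcp : f.charpoly = φ.charpoly.map (algebraMap ℚ ℂ) := LinearMap.charpoly_baseChange ..
  have hfr : ∀ z : ℂ, f.charpoly.IsRoot z ↔ Polynomial.aeval z φ.charpoly = 0 := by
    intro z
    rw [hcp, Polynomial.IsRoot.def, Polynomial.eval_map_algebraMap]
  have hxr : f.charpoly.IsRoot (x : ℂ) := by
    rw [hfr]
    have := Polynomial.aeval_algebraMap_apply ℂ x φ.charpoly
    rw [hx, map_zero] at this
    exact this
  have hmult : f.charpoly.rootMultiplicity (x : ℂ) ≤ 1 := by
    refine rootMult_le _ (2 * n) f.charpoly_monic.ne_zero ?_ lam hinj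
      (fun i => (hfr _).2 (hroot i)) _
    rw [LinearMap.charpoly_natDegree, Module.finrank_baseChange, hdim]
  have hE : Module.finrank ℂ (f.eigenspace (x : ℂ)) ≤ 1 :=
    (LinearMap.finrank_eigenspace_le f _).trans hmult
  -- no nonzero eigenvector in `W`
  have key : ∀ u ∈ W, f u = (x : ℂ) • u → u = 0 := by
    intro u hu hfu
    by_contra hne
    have hcu : f (conjV V u) = (x : ℂ) • conjV V u := by
      rw [hf, ← conjV_baseChange, ← hf, hfu, conjV_smul]
    obtain ⟨v, hv⟩ := finrank_le_one_iff.1 hE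
    obtain ⟨a, ha⟩ := hv ⟨u, Module.End.mem_eigenspace_iff.2 hfu⟩
    obtain ⟨b, hb⟩ := hv ⟨conjV V u, Module.End.mem_eigenspace_iff.2 hcu⟩
    have ha' : a • (v : ℂ ⊗[ℚ] V) = u := congrArg Subtype.val ha
    have hb' : b • (v : ℂ ⊗[ℚ] V) = conjV V u := congrArg Subtype.val hb
    have ha0 : a ≠ 0 := by
      rintro rfl
      exact hne (by rw [← ha', zero_smul])
    have hmem : conjV V u ∈ W := by
      have hvW : (v : ℂ ⊗[ℚ] V) ∈ W := by
        rw [← inv_smul_smul₀ ha0 (v : ℂ ⊗[ℚ] V), ha']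
        exact W.smul_mem _ hu
      rw [← hb']
      exact W.smul_mem _ hvW
    have h0 : conjV V u ∈ W.restrictScalars ℚ ⊓ conjSub V W := ⟨hmem, ⟨u, hu, rfl⟩⟩
    rw [hWinf, Submodule.mem_bot] at h0
    apply hne
    rw [← conjV_conjV V u, h0, map_zero]
  obtain ⟨v, hv⟩ := (f.hasEigenvalue_iff_isRoot_charpoly (x : ℂ) |>.2 hxr).exists_hasEigenvector
  have hfv : f v = (x : ℂ) • v := hv.apply_eq_smul
  have hvt : v ∈ W.restrictScalars ℚ ⊔ conjSub V W := by rw [hWsup]; trivial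
  obtain ⟨w, hw, c, ⟨w', hw', rfl⟩, hsum⟩ := Submodule.mem_sup.1 hvt
  have hw1 : w ∈ W := hw
  have hw2 : w' ∈ W := hw'
  have hA : f w - (x : ℂ) • w = conjV V ((x : ℂ) • w' - f w') := by
    rw [map_sub, conjV_smul, hf, conjV_baseChange, ← hf, sub_eq_sub_iff_add_eq_add, ← map_add,
      hsum, hfv, ← hsum, smul_add, add_comm]
  have h0 : f w - (x : ℂ) • w ∈ W.restrictScalars ℚ ⊓ conjSub V W :=
    ⟨W.sub_mem (hWinv _ hw1) (W.smul_mem _ hw1),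
      ⟨_, W.sub_mem (W.smul_mem _ hw2) (hWinv _ hw2), hA.symm⟩⟩
  rw [hWinf, Submodule.mem_bot] at h0
  have h1 : w = 0 := key w hw1 (sub_eq_zero.1 h0)
  rw [h0] at hA
  have h2 : (x : ℂ) • w' - f w' = 0 := by
    rw [← conjV_conjV V ((x : ℂ) • w' - f w'), ← hA, map_zero]
  have h3 : w' = 0 := key w' hw2 (sub_eq_zero.1 h2).symm
  apply hv.2
  rw [← hsum, h1, h3, map_zero, add_zero]

end VoisinPaper
end
end

section
/- The products of pairs of roots are pairwise distinct: for 2-element subsets {i,j} and {k,l} of {1,…,2n}, if λ_i·λ_j = λ_k·λ_l then {i,j} = {k,l}. -/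
open scoped TensorProduct

noncomputable section

namespace VoisinPaper

/-- The splitting field of a polynomial with roots `lam 0, …, lam (m-1)`, realized as the
subfield of `ℂ` generated by the roots. -/
def splittingFieldOfRoots (m : ℕ) (lam : Fin m → ℂ) : IntermediateField ℚ ℂ :=
  IntermediateField.adjoin ℚ (Set.range lam)

lemma root_mem_splittingFieldOfRoots (m : ℕ) (lam : Fin m → ℂ) (i : Fin m) :
    lam i ∈ splittingFieldOfRoots m lam :=
  IntermediateField.subset_adjoin ℚ _ ⟨i, rfl⟩

/-- Condition (*): the Galois group of the splitting field of the roots over `ℚ` acts on the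
set of roots as the full symmetric group on `m` letters. -/
def galoisActsFully (m : ℕ) (lam : Fin m → ℂ) : Prop :=
  ∀ τ : Equiv.Perm (Fin m),
    ∃ σ : (splittingFieldOfRoots m lam) ≃ₐ[ℚ] (splittingFieldOfRoots m lam),
      ∀ i, (σ ⟨lam i, root_mem_splittingFieldOfRoots m lam i⟩ : ℂ) = lam (τ i)

lemma prod_perm (m : ℕ) (lam : Fin m → ℂ) (hgal : galoisActsFully m lam)
    (τ : Equiv.Perm (Fin m)) (s t : Finset (Fin m))
    (h : ∏ i ∈ s, lam i = ∏ i ∈ t, lam i) :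
    ∏ i ∈ s, lam (τ i) = ∏ i ∈ t, lam (τ i) := by
  obtain ⟨σ, hσ⟩ := hgal τ
  let r : Fin m → splittingFieldOfRoots m lam :=
    fun i => ⟨lam i, root_mem_splittingFieldOfRoots m lam i⟩
  have key : ∀ u : Finset (Fin m),
      ((σ (∏ i ∈ u, r i) : splittingFieldOfRoots m lam) : ℂ) = ∏ i ∈ u, lam (τ i) := by
    intro u
    rw [map_prod, ← IntermediateField.algebraMap_apply, map_prod]
    exact Finset.prod_congr rfl fun i _ => hσ i
  have hr : ∏ i ∈ s, r i = ∏ i ∈ t, r i := by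
    apply (algebraMap (splittingFieldOfRoots m lam) ℂ).injective
    rw [map_prod, map_prod]
    exact h
  rw [← key s, ← key t, hr]

/-- For a monic rational polynomial of degree `2n` (`n ≥ 4`) with `2n` distinct
complex roots on which the Galois group of its splitting field acts as the full symmetric group,
the products of pairs of roots are pairwise distinct: if the products of the roots indexed by two
2-element subsets agree, the subsets agree. -/
theorem products_of_pairs_of_roots_distinct
    (n : ℕ) (hn : 4 ≤ n)
    (f : Polynomial ℚ) (hmonic : f.Monic) (hdeg : f.natDegree = 2 * n)
    (lam : Fin (2 * n) → ℂ) (hinj : Function.Injective lam)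
    (hroot : ∀ i, Polynomial.aeval (lam i) f = 0)
    (hgal : galoisActsFully (2 * n) lam) :
    ∀ s t : Finset (Fin (2 * n)), s.card = 2 → t.card = 2 →
      ∏ i ∈ s, lam i = ∏ i ∈ t, lam i → s = t := by
  intro s t hs ht h
  have hne : ∀ i, lam i ≠ 0 := by
    intro i hi
    obtain ⟨j, hj⟩ : ∃ j, j ≠ i := by
      haveI : Nontrivial (Fin (2 * n)) := Fin.nontrivial_iff_two_le.2 (by omega)
      exact exists_ne i
    obtain ⟨σ, hσ⟩ := hgal (Equiv.swap i j)
    have h1 := hσ i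
    rw [Equiv.swap_apply_left] at h1
    have h0 : (⟨lam i, root_mem_splittingFieldOfRoots _ lam i⟩ :
        splittingFieldOfRoots (2 * n) lam) = 0 := Subtype.ext hi
    rw [h0, map_zero] at h1
    exact hj (hinj (h1.symm.trans (by simpa using hi.symm)))
  by_contra hst
  have hsub : ¬ s ⊆ t := fun hsub => hst (Finset.eq_of_subset_of_card_le hsub (by omega))
  obtain ⟨a, has, hat⟩ := Finset.not_subset.1 hsub
  obtain ⟨e, he⟩ : ∃ e, e ∉ s ∪ t := by
    by_contra! hall
    have h1 : (s ∪ t) = Finset.univ := Finset.eq_univ_iff_forall.2 hall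
    have h2 := Finset.card_union_le s t
    rw [h1, Finset.card_univ, Fintype.card_fin] at h2
    omega
  rw [Finset.mem_union, not_or] at he
  have h2 := prod_perm _ lam hgal (Equiv.swap a e) s t h
  have ht' : ∏ i ∈ t, lam (Equiv.swap a e i) = ∏ i ∈ t, lam i := by
    refine Finset.prod_congr rfl fun i hi => ?_
    rw [Equiv.swap_apply_of_ne_of_ne]
    · rintro rfl; exact hat hi
    · rintro rfl; exact he.2 hi
  have hs' : ∏ i ∈ s.erase a, lam (Equiv.swap a e i) = ∏ i ∈ s.erase a, lam i := by
    refine Finset.prod_congr rfl fun i hi => ?_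
    rw [Equiv.swap_apply_of_ne_of_ne]
    · exact Finset.ne_of_mem_erase hi
    · rintro rfl; exact he.1 (Finset.mem_of_mem_erase hi)
  rw [ht', ← h, ← Finset.mul_prod_erase s _ has, ← Finset.mul_prod_erase s lam has, hs',
    Equiv.swap_apply_left] at h2
  have h3 := mul_right_cancel₀ (Finset.prod_ne_zero_iff.2 fun i _ => hne i) h2
  exact he.1 (hinj h3 ▸ has)

end VoisinPaper
end
end

section
/- The products of quadruples of roots are pairwise distinct: for 4-element subsets A and B of {1,…,2n}, if ∏_{i∈A} λ_i = ∏_{i∈B} λ_i then A = B. -/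
open scoped TensorProduct

noncomputable section

namespace VoisinPaper

/-- For a monic rational polynomial of degree `2n` (`n ≥ 4`) with `2n` distinct
complex roots on which the Galois group of its splitting field acts as the full symmetric group,
the products of quadruples of roots are pairwise distinct: if the products of the roots indexed
by two 4-element subsets agree, the subsets agree. -/
theorem products_of_quadruples_of_roots_distinct
    (n : ℕ) (hn : 4 ≤ n)
    (f : Polynomial ℚ) (hmonic : f.Monic) (hdeg : f.natDegree = 2 * n)
    (lam : Fin (2 * n) → ℂ) (hinj : Function.Injective lam)
    (hroot : ∀ i, Polynomial.aeval (lam i) f = 0)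
    (hgal : galoisActsFully (2 * n) lam) :
    ∀ s t : Finset (Fin (2 * n)), s.card = 4 → t.card = 4 →
      ∏ i ∈ s, lam i = ∏ i ∈ t, lam i → s = t := by
  intro s t hs ht hst
  have key : ∀ (u v : Finset (Fin (2 * n))), ∏ i ∈ u, lam i = ∏ i ∈ v, lam i →
      ∀ τ : Equiv.Perm (Fin (2 * n)), ∏ i ∈ u, lam (τ i) = ∏ i ∈ v, lam (τ i) := by
    intro u v huv τ
    obtain ⟨σ, hσ⟩ := hgal τ
    let x : Fin (2 * n) → splittingFieldOfRoots (2 * n) lam :=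
      fun i => ⟨lam i, root_mem_splittingFieldOfRoots (2 * n) lam i⟩
    have hc : ∀ w : Finset (Fin (2 * n)),
        ((∏ i ∈ w, x i : splittingFieldOfRoots (2 * n) lam) : ℂ) = ∏ i ∈ w, lam i := by
      intro w
      exact map_prod (splittingFieldOfRoots (2 * n) lam).val x w
    have hc' : ∀ w : Finset (Fin (2 * n)),
        ((σ (∏ i ∈ w, x i) : splittingFieldOfRoots (2 * n) lam) : ℂ) = ∏ i ∈ w, lam (τ i) := by
      intro w
      rw [map_prod]
      refine (map_prod (splittingFieldOfRoots (2 * n) lam).val (fun i => σ (x i)) w).trans ?_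
      exact Finset.prod_congr rfl fun i _ => hσ i
    have hx : ∏ i ∈ u, x i = ∏ i ∈ v, x i := by
      apply Subtype.ext
      rw [hc, hc, huv]
    rw [← hc', ← hc', hx]
  have hne : ∀ i, lam i ≠ 0 := by
    intro i hi
    obtain ⟨j, hj⟩ : ∃ j : Fin (2 * n), j ≠ i := by
      have : Nontrivial (Fin (2 * n)) := Fin.nontrivial_iff_two_le.2 (by omega)
      exact exists_ne i
    obtain ⟨σ, hσ⟩ := hgal (Equiv.swap i j)
    have h1 := hσ i
    have h0 : (⟨lam i, root_mem_splittingFieldOfRoots (2 * n) lam i⟩ :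
        splittingFieldOfRoots (2 * n) lam) = 0 := Subtype.ext hi
    rw [h0, map_zero, Equiv.swap_apply_left] at h1
    exact hj (hinj (h1.symm.trans hi.symm))
  by_contra hne_st
  obtain ⟨a, has, hat⟩ : ∃ a ∈ s, a ∉ t := by
    by_contra! h
    exact hne_st (Finset.eq_of_subset_of_card_le h (by omega))
  obtain ⟨b, hbt, hbs⟩ : ∃ b ∈ t, b ∉ s := by
    by_contra! h
    exact hne_st (Finset.eq_of_subset_of_card_le h (by omega)).symm
  have hab : a ≠ b := fun h => hbs (h ▸ has)
  -- a permutation fixing everything in both sets except `a`, `b`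
  have step : ∀ τ : Equiv.Perm (Fin (2 * n)), lam (τ a) ^ 2 = lam (τ b) ^ 2 := by
    intro τ
    have e1 := key s t hst τ
    have e2 := key s t hst ((Equiv.swap a b).trans τ)
    rw [← Finset.mul_prod_erase s _ has, ← Finset.mul_prod_erase t _ hbt] at e1 e2
    have f1 : ∏ i ∈ s.erase a, lam (((Equiv.swap a b).trans τ) i)
        = ∏ i ∈ s.erase a, lam (τ i) := by
      refine Finset.prod_congr rfl fun i hi => ?_
      rw [Equiv.trans_apply, Equiv.swap_apply_of_ne_of_ne (Finset.ne_of_mem_erase hi)]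
      rintro rfl
      exact hbs (Finset.mem_of_mem_erase hi)
    have f2 : ∏ i ∈ t.erase b, lam (((Equiv.swap a b).trans τ) i)
        = ∏ i ∈ t.erase b, lam (τ i) := by
      refine Finset.prod_congr rfl fun i hi => ?_
      rw [Equiv.trans_apply, Equiv.swap_apply_of_ne_of_ne _ (Finset.ne_of_mem_erase hi)]
      rintro rfl
      exact hat (Finset.mem_of_mem_erase hi)
    rw [f1, f2] at e2
    simp only [Equiv.trans_apply, Equiv.swap_apply_left, Equiv.swap_apply_right] at e2
    have hP : ∏ i ∈ s.erase a, lam (τ i) ≠ 0 := Finset.prod_ne_zero_iff.2 fun i _ => hne _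
    have hQ : ∏ i ∈ t.erase b, lam (τ i) ≠ 0 := Finset.prod_ne_zero_iff.2 fun i _ => hne _
    generalize ∏ i ∈ s.erase a, lam (τ i) = P at *
    generalize ∏ i ∈ t.erase b, lam (τ i) = Q at *
    apply mul_right_cancel₀ (mul_ne_zero hP hQ)
    linear_combination lam (τ a) * Q * e1 - lam (τ b) * Q * e2
  obtain ⟨c, hcs, hca⟩ := Finset.exists_mem_ne (by omega : 1 < s.card) a
  have hcb : c ≠ b := fun h => hbs (h ▸ hcs)
  have g1 := step (Equiv.refl _)
  have g2 := step (Equiv.swap b c)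
  rw [Equiv.swap_apply_of_ne_of_ne hab hca.symm, Equiv.swap_apply_left] at g2
  simp only [Equiv.refl_apply] at g1
  rcases sq_eq_sq_iff_eq_or_eq_neg.1 g1 with h | h
  · exact hab (hinj h)
  rcases sq_eq_sq_iff_eq_or_eq_neg.1 g2 with h' | h'
  · exact hca (hinj h').symm
  · exact hcb (hinj (neg_injective (h'.symm.trans h)))

end VoisinPaper
end
end

section
/- The endomorphism ∧²φ of ∧²V acts irreducibly: the only ℚ-subspaces of ∧²V invariant under ∧²φ are 0 and ∧²V. -/
open scoped TensorProduct

noncomputable section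

namespace VoisinPaper

/-- The alternating 2-form `l ∧ m`. -/
def wedgeForm {V : Type} [AddCommGroup V] [Module ℚ V] (l m : V →ₗ[ℚ] ℂ) :
    V [⋀^Fin 2]→ₗ[ℚ] ℂ where
  toFun v := l (v 0) * m (v 1) - m (v 0) * l (v 1)
  map_update_add' v i x y := by
    fin_cases i <;> simp [Function.update] <;> ring
  map_update_smul' v i c x := by
    fin_cases i <;> simp [Function.update, Algebra.smul_def] <;> ring
  map_eq_zero_of_eq' v i j h hij := by
    fin_cases i <;> fin_cases j <;> simp_all <;> ring

/-- The linear form on the exterior algebra associated with `l ∧ m`. -/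
def wedgeLin {V : Type} [AddCommGroup V] [Module ℚ V] (l m : V →ₗ[ℚ] ℂ) :
    ExteriorAlgebra ℚ V →ₗ[ℚ] ℂ :=
  ExteriorAlgebra.liftAlternating (Pi.single 2 (wedgeForm l m))

lemma wedgeLin_ιMulti {V : Type} [AddCommGroup V] [Module ℚ V] (l m : V →ₗ[ℚ] ℂ)
    (v : Fin 2 → V) : wedgeLin l m (ExteriorAlgebra.ιMulti ℚ 2 v) =
      l (v 0) * m (v 1) - m (v 0) * l (v 1) := by
  rw [wedgeLin, ExteriorAlgebra.liftAlternating_apply_ιMulti, Pi.single_eq_same]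
  rfl

lemma wedgeLin_map {V : Type} [AddCommGroup V] [Module ℚ V] (φ : V →ₗ[ℚ] V)
    (l m : V →ₗ[ℚ] ℂ) (a b : ℂ) (hl : ∀ v, l (φ v) = a * l v) (hm : ∀ v, m (φ v) = b * m v)
    (x : ExteriorAlgebra ℚ V) (hx : x ∈ ⋀[ℚ]^2 V) :
    wedgeLin l m (ExteriorAlgebra.map φ x) = a * b * wedgeLin l m x := by
  rw [← ExteriorAlgebra.ιMulti_span_fixedDegree] at hx
  induction hx using Submodule.span_induction with
  | mem x h =>
    obtain ⟨v, rfl⟩ := h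
    rw [ExteriorAlgebra.map_apply_ιMulti, wedgeLin_ιMulti, wedgeLin_ιMulti]
    simp only [Function.comp_apply, hl, hm]
    ring
  | zero => simp
  | add x y _ _ hx hy => simp only [map_add, hx, hy]; ring
  | smul c x _ hx => simp only [map_smul, hx]; rw [mul_smul_comm]

lemma eq_of_ιMulti {V : Type} [AddCommGroup V] [Module ℚ V]
    (f g : ExteriorAlgebra ℚ V →ₗ[ℚ] ℂ)
    (h : ∀ v : Fin 2 → V, f (ExteriorAlgebra.ιMulti ℚ 2 v) = g (ExteriorAlgebra.ιMulti ℚ 2 v))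
    (x : ExteriorAlgebra ℚ V) (hx : x ∈ ⋀[ℚ]^2 V) : f x = g x := by
  rw [← ExteriorAlgebra.ιMulti_span_fixedDegree] at hx
  refine LinearMap.eqOn_span (s := Set.range (ExteriorAlgebra.ιMulti ℚ 2)) ?_ hx
  rintro _ ⟨v, rfl⟩
  exact h v

/-- If the forms `l i` span all coordinates then the forms `l i ∧ l j` are jointly injective. -/
lemma wedge_injective {V : Type} [AddCommGroup V] [Module ℚ V] {N : ℕ}
    (b : Module.Basis (Fin N) ℚ V) (l : Fin N → V →ₗ[ℚ] ℂ) (M : Fin N → Fin N → ℂ)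
    (hM : ∀ k v, ((b.repr v k : ℚ) : ℂ) = ∑ i, M k i * l i v)
    (x : ExteriorAlgebra ℚ V) (hx : x ∈ ⋀[ℚ]^2 V)
    (h : ∀ i j, wedgeLin (l i) (l j) x = 0) : x = 0 := by
  let c : Fin N → V →ₗ[ℚ] ℂ := fun k => (Algebra.linearMap ℚ ℂ) ∘ₗ b.coord k
  have hc : ∀ k v, c k v = ((b.repr v k : ℚ) : ℂ) := fun k v => by simp [c]
  have hcl : ∀ k v, c k v = ∑ i, M k i * l i v := fun k v => by rw [hc, hM]
  have h1 : ∀ k k', wedgeLin (c k) (c k') x = 0 := by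
    intro k k'
    have := eq_of_ιMulti (wedgeLin (c k) (c k'))
      (∑ i, ∑ j, (M k i * M k' j) • wedgeLin (l i) (l j)) (by
        intro v
        simp only [LinearMap.sum_apply, LinearMap.smul_apply, wedgeLin_ιMulti, hcl, smul_eq_mul,
          mul_sub, Finset.sum_sub_distrib]
        rw [Finset.sum_mul_sum, mul_comm (∑ i, M k' i * _), Finset.sum_mul_sum]
        congr 1 <;> refine Finset.sum_congr rfl fun i _ => Finset.sum_congr rfl fun j _ => ?_ <;>
          ring) x hx
    rw [this]
    simp [LinearMap.sum_apply, h]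
  rw [← Module.forall_dual_apply_eq_zero_iff ℚ x]
  intro f
  have hB : ∀ v w : V, ((f (ExteriorAlgebra.ι ℚ v * ExteriorAlgebra.ι ℚ w) : ℚ) : ℂ) =
      ∑ k, ∑ k', ((f (ExteriorAlgebra.ι ℚ (b k) * ExteriorAlgebra.ι ℚ (b k')) : ℚ) : ℂ) *
        (c k v * c k' w) := by
    intro v w
    conv_lhs => rw [← b.sum_repr v, ← b.sum_repr w]
    simp only [map_sum, map_smul, Finset.sum_mul_sum, smul_mul_smul_comm, Rat.cast_sum, hc,
      smul_eq_mul, Rat.cast_mul]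
    refine Finset.sum_congr rfl fun i _ => Finset.sum_congr rfl fun j _ => ?_
    ring
  have h2 := eq_of_ιMulti ((2 : ℂ) • ((Algebra.linearMap ℚ ℂ) ∘ₗ f))
    (∑ k, ∑ k', ((f (ExteriorAlgebra.ι ℚ (b k) * ExteriorAlgebra.ι ℚ (b k')) : ℚ) : ℂ) •
      wedgeLin (c k) (c k')) (by
      intro v
      simp only [LinearMap.sum_apply, LinearMap.smul_apply, wedgeLin_ιMulti, smul_eq_mul,
        mul_sub, Finset.sum_sub_distrib]
      have e1 : ExteriorAlgebra.ιMulti ℚ 2 v =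
          ExteriorAlgebra.ι ℚ (v 0) * ExteriorAlgebra.ι ℚ (v 1) := by
        simp [ExteriorAlgebra.ιMulti_apply]
        rfl
      have e2 : ExteriorAlgebra.ι ℚ (v 1) * ExteriorAlgebra.ι ℚ (v 0) =
          -(ExteriorAlgebra.ι ℚ (v 0) * ExteriorAlgebra.ι ℚ (v 1)) := by
        rw [eq_neg_iff_add_eq_zero]
        exact ExteriorAlgebra.ι_add_mul_swap _ _
      have e3 := hB (v 1) (v 0)
      rw [e2, map_neg] at e3
      simp only [mul_comm (c _ (v 1))] at e3
      rw [← hB (v 0) (v 1), ← e3, e1]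
      simp
      ring) x hx
  simp [LinearMap.sum_apply, h1] at h2
  exact h2

lemma exists_forms {V : Type} [AddCommGroup V] [Module ℚ V] [FiniteDimensional ℚ V] {N : ℕ}
    (b : Module.Basis (Fin N) ℚ V) (φ : V →ₗ[ℚ] V) (lam : Fin N → ℂ)
    (hinj : Function.Injective lam)
    (hroot : ∀ i, Polynomial.aeval (lam i) (LinearMap.charpoly φ) = 0) :
    ∃ l : Fin N → V →ₗ[ℚ] ℂ, ∃ M : Fin N → Fin N → ℂ,
      (∀ k v, ((b.repr v k : ℚ) : ℂ) = ∑ i, M k i * l i v) ∧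
      ∀ i v, l i (φ v) = lam i * l i v := by
  classical
  set A : Matrix (Fin N) (Fin N) ℂ :=
    (LinearMap.toMatrix b b φ).map (algebraMap ℚ ℂ) with hA
  have hu : ∀ i, ∃ u : Fin N → ℂ, u ≠ 0 ∧ A.transpose.mulVec u = lam i • u := by
    intro i
    have h1 : (Matrix.scalar (Fin N) (lam i) - A.transpose).det = 0 := by
      rw [← Matrix.eval_charpoly, Matrix.charpoly_transpose, hA, Matrix.charpoly_map,
        LinearMap.charpoly_toMatrix, Polynomial.eval_map_algebraMap]
      exact hroot i
    obtain ⟨u, hu0, hu⟩ := Matrix.exists_mulVec_eq_zero_iff.2 h1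
    refine ⟨u, hu0, ?_⟩
    rw [Matrix.sub_mulVec, sub_eq_zero] at hu
    rw [← hu]
    ext k
    simp [Matrix.mulVec_diagonal]
  choose u hu0 hu using hu
  have hli : LinearIndependent ℂ u := by
    refine Module.End.eigenvectors_linearIndependent' (Matrix.toLin' A.transpose) lam hinj u ?_
    intro i
    rw [Module.End.hasEigenvector_iff, Module.End.mem_eigenspace_iff]
    exact ⟨by rw [Matrix.toLin'_apply, hu], hu0 i⟩
  have hunit : IsUnit (Matrix.of u) := by
    rw [← Matrix.linearIndependent_rows_iff_isUnit]
    exact hli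
  let c : Fin N → V →ₗ[ℚ] ℂ := fun k => (Algebra.linearMap ℚ ℂ) ∘ₗ b.coord k
  have hc : ∀ k v, c k v = ((b.repr v k : ℚ) : ℂ) := fun k v => by simp [c]
  have hcφ : ∀ k v, c k (φ v) = ∑ j, A k j * c j v := by
    intro k v
    have := congrFun (LinearMap.toMatrix_mulVec_repr b b φ v) k
    rw [hc, ← this]
    simp [Matrix.mulVec, dotProduct, hA, hc]
  let l : Fin N → V →ₗ[ℚ] ℂ := fun i => ∑ k, u i k • c k
  have hl : ∀ i v, l i v = ∑ k, u i k * c k v := fun i v => by simp [l]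
  let U' : Matrix (Fin N) (Fin N) ℂ := (Matrix.of u)⁻¹
  refine ⟨l, U', ?_, ?_⟩
  · intro k v
    have h1 : (fun i => l i v) = (Matrix.of u).mulVec (fun k => c k v) := by
      ext i; rw [hl]; rfl
    have h2 : (Matrix.of u)⁻¹.mulVec (fun i => l i v) = fun k => c k v := by
      rw [h1, Matrix.mulVec_mulVec, Matrix.nonsing_inv_mul _ ((Matrix.isUnit_iff_isUnit_det _).1 hunit),
        Matrix.one_mulVec]
    rw [← hc]
    exact (congrFun h2 k).symm
  · intro i v
    rw [hl, hl]
    simp only [hcφ, Finset.mul_sum]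
    rw [Finset.sum_comm]
    refine Finset.sum_congr rfl fun j _ => ?_
    have := congrFun (hu i) j
    simp only [Matrix.mulVec, dotProduct, Matrix.transpose_apply, Pi.smul_apply, smul_eq_mul] at this
    rw [← mul_assoc, ← this, Finset.sum_mul]
    refine Finset.sum_congr rfl fun k _ => by ring

lemma gal_prod_eq {m : ℕ} {lam : Fin m → ℂ} (hgal : galoisActsFully m lam)
    (τ : Equiv.Perm (Fin m)) {i j k l : Fin m} (h : lam i * lam j = lam k * lam l) :
    lam (τ i) * lam (τ j) = lam (τ k) * lam (τ l) := by
  obtain ⟨σ, hσ⟩ := hgal τ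
  rw [← hσ, ← hσ, ← hσ, ← hσ]
  have : (⟨lam i, root_mem_splittingFieldOfRoots m lam i⟩ : splittingFieldOfRoots m lam) *
      ⟨lam j, root_mem_splittingFieldOfRoots m lam j⟩ =
      ⟨lam k, root_mem_splittingFieldOfRoots m lam k⟩ *
      ⟨lam l, root_mem_splittingFieldOfRoots m lam l⟩ := Subtype.ext h
  have h2 := congrArg σ this
  rw [map_mul, map_mul] at h2
  exact congrArg Subtype.val h2

lemma lam_ne_zero {m : ℕ} (hm : 2 ≤ m) {lam : Fin m → ℂ} (hinj : Function.Injective lam)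
    (hgal : galoisActsFully m lam) (i : Fin m) : lam i ≠ 0 := by
  intro h0
  have : Nontrivial (Fin m) := Fin.nontrivial_iff_two_le.2 hm
  obtain ⟨j, hj⟩ := exists_ne i
  obtain ⟨σ, hσ⟩ := hgal (Equiv.swap i j)
  have h1 := hσ i
  rw [Equiv.swap_apply_left] at h1
  have h2 : (⟨lam i, root_mem_splittingFieldOfRoots m lam i⟩ : splittingFieldOfRoots m lam) = 0 :=
    Subtype.ext h0
  rw [h2, map_zero] at h1
  exact hj (hinj (by rw [← h1, h0]; rfl))

lemma prod_inj {m : ℕ} (hm : 5 ≤ m) {lam : Fin m → ℂ} (hinj : Function.Injective lam)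
    (hgal : galoisActsFully m lam) {i j k l : Fin m} (hij : i ≠ j) (hkl : k ≠ l)
    (h : lam i * lam j = lam k * lam l) : (i = k ∧ j = l) ∨ (i = l ∧ j = k) := by
  have h0 := lam_ne_zero (by omega) hinj hgal
  by_cases h1 : i = k
  · subst h1; exact Or.inl ⟨rfl, hinj (mul_left_cancel₀ (h0 i) h)⟩
  by_cases h2 : i = l
  · subst h2
    exact Or.inr ⟨rfl, hinj (mul_left_cancel₀ (h0 i) (h.trans (mul_comm _ _)))⟩
  by_cases h3 : j = k
  · subst h3
    exact absurd (hinj (mul_left_cancel₀ (h0 j) ((mul_comm _ _).trans h))) h2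
  by_cases h4 : j = l
  · subst h4
    exact absurd (hinj (mul_right_cancel₀ (h0 j) h)) h1
  exfalso
  obtain ⟨p, hp⟩ : ∃ p, p ∉ ({i, j, k, l} : Finset (Fin m)) := by
    by_contra! hc
    have h5 : (Finset.univ : Finset (Fin m)).card ≤ ({i, j, k, l} : Finset (Fin m)).card :=
      Finset.card_le_card fun x _ => hc x
    have h6 := Finset.card_le_four (a := i) (b := j) (c := k) (d := l)
    simp at h5
    omega
  simp only [Finset.mem_insert, Finset.mem_singleton, not_or] at hp
  have h7 := gal_prod_eq hgal (Equiv.swap l p) h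
  rw [Equiv.swap_apply_of_ne_of_ne h2 (Ne.symm hp.1),
    Equiv.swap_apply_of_ne_of_ne h4 (Ne.symm hp.2.1),
    Equiv.swap_apply_of_ne_of_ne hkl (Ne.symm hp.2.2.1), Equiv.swap_apply_left, h] at h7
  exact hp.2.2.2 (hinj (mul_left_cancel₀ (h0 k) h7)).symm

lemma charpoly_integral {m : ℕ} {lam : Fin m → ℂ} (hint : ∀ i, IsIntegral ℚ (lam i))
    (hm : 5 ≤ m) (hinj : Function.Injective lam)
    (hgal : galoisActsFully m lam) {i j : Fin m} (hij : i ≠ j) :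
    m.choose 2 ≤ (minpoly ℚ (lam i * lam j)).natDegree := by
  classical
  have hα : IsIntegral ℚ (lam i * lam j) := (hint i).mul (hint j)
  let Z : Finset ℂ := ((Finset.univ : Finset (Fin m)).powersetCard 2).image fun s => ∏ i ∈ s, lam i
  have hZ : Z.card = m.choose 2 := by
    rw [Finset.card_image_of_injOn, Finset.card_powersetCard, Finset.card_fin]
    intro s hs t ht hst
    rw [Finset.mem_coe, Finset.mem_powersetCard] at hs ht
    obtain ⟨a, b, hab, rfl⟩ := Finset.card_eq_two.1 hs.2
    obtain ⟨c, d, hcd, rfl⟩ := Finset.card_eq_two.1 ht.2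
    simp only [Finset.prod_pair hab, Finset.prod_pair hcd] at hst
    rcases prod_inj hm hinj hgal hab hcd hst with ⟨rfl, rfl⟩ | ⟨rfl, rfl⟩
    · rfl
    · exact Finset.pair_comm _ _
  rw [← hZ, ← Polynomial.natDegree_map (algebraMap ℚ ℂ)]
  refine Polynomial.card_le_degree_of_subset_roots ?_
  intro z hz
  have hz' : z ∈ Z := hz
  simp only [Z, Finset.mem_image, Finset.mem_powersetCard] at hz'
  obtain ⟨s, ⟨-, hs⟩, rfl⟩ := hz'
  obtain ⟨a, b, hab, rfl⟩ := Finset.card_eq_two.1 hs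
  rw [Finset.prod_pair hab, Polynomial.mem_roots', Polynomial.IsRoot, Polynomial.eval_map_algebraMap]
  refine ⟨(Polynomial.map_ne_zero (minpoly.ne_zero hα)), ?_⟩
  obtain ⟨τ, h1, h2⟩ : ∃ τ : Equiv.Perm (Fin m), τ i = a ∧ τ j = b := by
    have := (MulAction.is_two_pretransitive_iff (G := Equiv.Perm (Fin m)) (α := Fin m)).1
      (Equiv.Perm.isMultiplyPretransitive (Fin m) 2) hij hab
    simpa using this
  obtain ⟨σ, hσ⟩ := hgal τ
  let K := splittingFieldOfRoots m lam
  let ri : K := ⟨lam i, root_mem_splittingFieldOfRoots m lam i⟩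
  let rj : K := ⟨lam j, root_mem_splittingFieldOfRoots m lam j⟩
  let g : K →ₐ[ℚ] ℂ := K.val.comp σ.toAlgHom
  have e1 : g (ri * rj) = lam a * lam b := by
    rw [map_mul, ← h1, ← h2, ← hσ, ← hσ]; rfl
  have e2 : K.val (ri * rj) = lam i * lam j := rfl
  rw [← e1, Polynomial.aeval_algHom_apply, ← e2, 
    minpoly.algHom_eq K.val K.val.injective]
  exact (congrArg g (minpoly.aeval ℚ (ri * rj))).trans (map_zero g)

/-- Under condition (*), the endomorphism `⋀²φ` of `⋀²V` acts irreducibly: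
the only `ℚ`-subspaces of `⋀²V` invariant under `⋀²φ` are `0` and `⋀²V`. -/
theorem extPow_two_irreducible_action
    (n : ℕ) (hn : 4 ≤ n)
    (V : Type) [AddCommGroup V] [Module ℚ V] [FiniteDimensional ℚ V]
    (hdim : Module.finrank ℚ V = 2 * n)
    (φ : V →ₗ[ℚ] V)
    (lam : Fin (2 * n) → ℂ) (hinj : Function.Injective lam)
    (hroot : ∀ i, Polynomial.aeval (lam i) (LinearMap.charpoly φ) = 0)
    (hgal : galoisActsFully (2 * n) lam) :
    ∀ S : Submodule ℚ (ExteriorAlgebra ℚ V), S ≤ ⋀[ℚ]^2 V →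
      Submodule.map (ExteriorAlgebra.map φ).toLinearMap S ≤ S →
      S = ⊥ ∨ S = ⋀[ℚ]^2 V := by
  intro S hS hinv
  by_cases hbot : S = ⊥
  · exact Or.inl hbot
  right
  obtain ⟨x, hxS, hx0⟩ := Submodule.exists_mem_ne_zero_of_ne_bot hbot
  let b : Module.Basis (Fin (2 * n)) ℚ V := Module.finBasisOfFinrankEq ℚ V hdim
  obtain ⟨l, M, hM, hl⟩ := exists_forms b φ lam hinj hroot
  obtain ⟨i, j, hω⟩ : ∃ i j, wedgeLin (l i) (l j) x ≠ 0 := by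
    by_contra! hc
    exact hx0 (wedge_injective b l M hM x (hS hxS) hc)
  have hij : i ≠ j := by
    rintro rfl
    refine hω ?_
    have hxx := hS hxS
    rw [← ExteriorAlgebra.ιMulti_span_fixedDegree] at hxx
    clear hω hxS hx0
    induction hxx using Submodule.span_induction with
    | mem x h =>
      obtain ⟨v, rfl⟩ := h
      rw [wedgeLin_ιMulti]; ring
    | zero => simp
    | add x y _ _ hx hy => rw [map_add, hx, hy, add_zero]
    | smul c x _ hx => rw [map_smul, hx, smul_zero]
  have hint : ∀ i, IsIntegral ℚ (lam i) := fun i =>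
    ⟨_, LinearMap.charpoly_monic φ, hroot i⟩
  have hdeg := charpoly_integral hint (by omega) hinj hgal hij
  set ψ := (ExteriorAlgebra.map φ).toLinearMap with hψ
  have hpow : ∀ k : ℕ, (ψ ^ k) x ∈ S ∧
      wedgeLin (l i) (l j) ((ψ ^ k) x) = (lam i * lam j) ^ k * wedgeLin (l i) (l j) x := by
    intro k
    induction k with
    | zero => simpa using hxS
    | succ k ih =>
      rw [pow_succ', Module.End.mul_apply]
      refine ⟨hinv (Submodule.mem_map_of_mem ih.1), ?_⟩
      have := wedgeLin_map φ (l i) (l j) _ _ (hl i) (hl j) _ (hS ih.1)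
      rw [ih.2] at this
      rw [pow_succ', mul_assoc, ← this]
      rfl
  have hli : LinearIndependent ℚ (fun k : Fin (minpoly ℚ (lam i * lam j)).natDegree =>
      (⟨(ψ ^ (k : ℕ)) x, (hpow k).1⟩ : S)) := by
    apply LinearIndependent.of_comp ((wedgeLin (l i) (l j)) ∘ₗ S.subtype)
    have h1 := (linearIndependent_pow (K := ℚ) (lam i * lam j)).map'
      (LinearMap.mulRight ℚ (wedgeLin (l i) (l j) x))
      (LinearMap.ker_eq_bot.2 (mul_left_injective₀ hω))
    have h3 : (((wedgeLin (l i) (l j)) ∘ₗ S.subtype) ∘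
        fun k : Fin (minpoly ℚ (lam i * lam j)).natDegree =>
          (⟨(ψ ^ (k : ℕ)) x, (hpow k).1⟩ : S)) =
        (LinearMap.mulRight ℚ (wedgeLin (l i) (l j) x)) ∘
          fun k : Fin (minpoly ℚ (lam i * lam j)).natDegree => (lam i * lam j) ^ (k : ℕ) := by
      funext k
      exact (hpow k).2
    rw [h3]
    exact h1
  have : FiniteDimensional ℚ (⋀[ℚ]^2 V) := inferInstance
  have : FiniteDimensional ℚ S := Submodule.finiteDimensional_of_le hS
  have h2 := hli.fintype_card_le_finrank
  rw [Fintype.card_fin] at h2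
  refine Submodule.eq_of_le_of_finrank_le hS ?_
  rw [exteriorPower.finrank_eq, hdim]
  exact hdeg.trans h2

end VoisinPaper
end
end

section
/- The endomorphism ∧⁴φ of ∧⁴V acts irreducibly: the only ℚ-subspaces of ∧⁴V invariant under ∧⁴φ are 0 and ∧⁴V. -/
open scoped TensorProduct

noncomputable section

namespace VoisinPaper

section Aux
open Polynomial

lemma aux_irred {E : Type*} [AddCommGroup E] [Module ℚ E] [FiniteDimensional ℚ E]
    (ψ : E →ₗ[ℚ] E) (Z : Finset ℂ) (hZ : Z.card = Module.finrank ℚ E)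
    (hr : ∀ z ∈ Z, aeval z ψ.charpoly = 0)
    (hc : ∀ p : ℚ[X], ∀ z ∈ Z, aeval z p = 0 → ∀ w ∈ Z, aeval w p = 0)
    (S : Submodule ℚ E) (hS : ∀ x ∈ S, ψ x ∈ S) : S = ⊥ ∨ S = ⊤ := by
  by_cases hbot : S = ⊥
  · exact Or.inl hbot
  right
  have hnt : Nontrivial S := (Submodule.nontrivial_iff_ne_bot).2 hbot
  set T : S →ₗ[ℚ] S := ψ.restrict hS with hT
  have hae : ∀ (p : ℚ[X]) (x : S), ((aeval T p x : S) : E) = aeval ψ p (x : E) := by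
    intro p
    induction p using Polynomial.induction_on' with
    | add p q hp hq => intro x; simp [hp, hq]
    | monomial k a =>
      intro x
      have : ∀ (k : ℕ), (((T ^ k) x : S) : E) = (ψ ^ k) (x : E) := by
        intro k
        induction k with
        | zero => simp
        | succ k ih => rw [pow_succ', pow_succ', Module.End.mul_apply, Module.End.mul_apply, ← ih]; rfl
      simp [aeval_monomial, this]
  have h0 : aeval T ψ.charpoly = 0 := by
    ext x
    rw [hae, LinearMap.aeval_self_charpoly]; simp
  have hdvd : minpoly ℚ T ∣ ψ.charpoly := minpoly.dvd _ _ h0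
  have hint : IsIntegral ℚ T := T.isIntegral
  obtain ⟨μ, hμ⟩ := IsAlgClosed.exists_aeval_eq_zero ℂ (minpoly ℚ T) (minpoly.degree_pos hint).ne'
  have key : ∀ p : ℚ[X], p ≠ 0 → (∀ z ∈ Z, aeval z p = 0) → Z.val ≤ p.aroots ℂ := by
    intro p hp h
    rw [Multiset.le_iff_subset Z.nodup]
    intro z hz
    rw [mem_aroots]
    exact ⟨hp, h z hz⟩
  have hq0 := ψ.charpoly_monic.ne_zero
  have hroots : Z.val = ψ.charpoly.aroots ℂ := by
    apply Multiset.eq_of_le_of_card_le (key _ hq0 hr)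
    refine (card_roots' _).trans ?_
    rw [natDegree_map, LinearMap.charpoly_natDegree, ← hZ]; rfl
  have hμZ : μ ∈ Z := by
    rw [← Finset.mem_val, hroots, mem_aroots]
    refine ⟨hq0, ?_⟩
    obtain ⟨g, hg⟩ := hdvd
    rw [hg, map_mul, hμ, zero_mul]
  have hall := hc _ μ hμZ hμ
  have hd : minpoly ℚ T ∣ T.charpoly := minpoly.dvd _ _ T.aeval_self_charpoly
  have h1 := Multiset.card_le_card (key _ (minpoly.ne_zero hint) hall)
  have h2 := (h1.trans (card_roots' _))
  rw [natDegree_map] at h2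
  have h3 := natDegree_le_of_dvd hd T.charpoly_monic.ne_zero
  rw [LinearMap.charpoly_natDegree] at h3
  apply Submodule.eq_top_of_finrank_eq
  apply le_antisymm (Submodule.finrank_le S)
  rw [← hZ]; exact h2.trans h3

lemma aux_functional {V : Type*} [AddCommGroup V] [Module ℚ V] [FiniteDimensional ℚ V]
    (φ : V →ₗ[ℚ] V) (μ : ℂ) (h : aeval μ φ.charpoly = 0) :
    ∃ l : V →ₗ[ℚ] ℂ, l ≠ 0 ∧ ∀ v, l (φ v) = μ * l v := by
  classical
  let b := Module.finBasis ℚ V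
  set M := LinearMap.toMatrix b b φ with hM
  have hd : (Matrix.scalar _ μ - M.map (algebraMap ℚ ℂ)).det = 0 := by
    rw [← Matrix.eval_charpoly, Matrix.charpoly_map, eval_map_algebraMap, hM,
      LinearMap.charpoly_toMatrix, h]
  obtain ⟨u, hu0, hu⟩ := Matrix.exists_vecMul_eq_zero_iff.2 hd
  have hl : ∀ j, b.constr ℚ u (b j) = u j := fun j => b.constr_basis ℚ u j
  refine ⟨b.constr ℚ u, ?_, ?_⟩
  · intro h0
    apply hu0
    ext j
    rw [← hl j, h0]; rfl
  · suffices hs : (b.constr ℚ u) ∘ₗ φ = (LinearMap.mulLeft ℚ μ) ∘ₗ (b.constr ℚ u) from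
      fun v => LinearMap.congr_fun hs v
    apply b.ext
    intro j
    have hj := congrFun hu j
    rw [Matrix.vecMul_sub] at hj
    simp only [LinearMap.comp_apply, LinearMap.mulLeft_apply, hl]
    rw [← b.sum_repr (φ (b j)), map_sum]
    simp only [map_smul, hl]
    have h4 : ∀ i, b.repr (φ (b j)) i = M i j := fun i => by rw [hM, LinearMap.toMatrix_apply]
    simp only [h4]
    simp [Matrix.vecMul, dotProduct, sub_eq_zero] at hj
    rw [hj]
    apply Finset.sum_congr rfl
    intro i _
    rw [Algebra.smul_def, mul_comm]; rfl

lemma aux_indep {V ι : Type*} [AddCommGroup V] [Module ℚ V]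
    (φ : V →ₗ[ℚ] V) (μ : ι → ℂ) (hinj : Function.Injective μ)
    (l : ι → V →ₗ[ℚ] ℂ) (h0 : ∀ i, l i ≠ 0) (h : ∀ i v, l i (φ v) = μ i * l i v) :
    LinearIndependent ℂ l := by
  let A : Module.End ℂ (V →ₗ[ℚ] ℂ) :=
    { toFun := fun f => f ∘ₗ φ
      map_add' := fun f g => by ext; rfl
      map_smul' := fun c f => by ext; rfl }
  refine Module.End.eigenvectors_linearIndependent' A μ hinj l fun i => ⟨?_, h0 i⟩
  rw [Module.End.mem_eigenspace_iff]
  ext v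
  exact h i v

lemma aux_det {V : Type*} [AddCommGroup V] [Module ℚ V] {k : ℕ}
    (l : Fin k → V →ₗ[ℚ] ℂ) (hl : LinearIndependent ℂ l) :
    ∃ v : Fin k → V, (Matrix.of fun i j => l j (v i)).det ≠ 0 := by
  classical
  let s : Set (Fin k → ℂ) := Set.range fun v : V => fun j => l j v
  have hs : Submodule.span ℂ s = ⊤ := by
    by_contra hne
    obtain ⟨f, hf0, hf⟩ := Submodule.exists_le_ker_of_lt_top _ (lt_top_iff_ne_top.2 hne)
    apply hf0
    have hz : ∀ j, f (Pi.single j 1) = 0 := by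
      refine Fintype.linearIndependent_iff.1 hl _ ?_
      ext v
      have hv : f (fun j => l j v) = 0 := hf (Submodule.subset_span ⟨v, rfl⟩)
      rw [pi_eq_sum_univ' (fun j => l j v), map_sum] at hv
      simp only [map_smul, smul_eq_mul] at hv
      simp only [LinearMap.sum_apply, LinearMap.smul_apply, smul_eq_mul, LinearMap.zero_apply]
      rw [← hv]
      apply Finset.sum_congr rfl
      intro i _
      rw [mul_comm]
    apply LinearMap.pi_ext'
    intro j
    ext
    simpa using hz j
  obtain ⟨f, hfs, -, hf⟩ := Submodule.exists_fun_fin_finrank_span_eq ℂ s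
  have hk : Module.finrank ℂ (Submodule.span ℂ s) = k := by rw [hs]; simp
  let g : Fin k → (Fin k → ℂ) := f ∘ Fin.cast hk.symm
  have hg : LinearIndependent ℂ g := hf.comp _ (Fin.cast_injective _)
  have hgs : ∀ i, ∃ v, (fun j => l j v) = g i := fun i => hfs _
  choose v hv using hgs
  refine ⟨v, ?_⟩
  have : (Matrix.of fun i j => l j (v i)) = Matrix.of g := by
    ext i j
    simp [← hv]
  rw [this]
  have hu : IsUnit (Matrix.of g) := Matrix.linearIndependent_rows_iff_isUnit.1 hg
  exact ((Matrix.isUnit_iff_isUnit_det _).1 hu).ne_zero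

lemma aux_wedge {V : Type*} [AddCommGroup V] [Module ℚ V] [FiniteDimensional ℚ V] {k : ℕ}
    (φ : V →ₗ[ℚ] V) (μ : Fin k → ℂ) (l : Fin k → V →ₗ[ℚ] ℂ) (hl : LinearIndependent ℂ l)
    (h : ∀ i v, l i (φ v) = μ i * l i v) :
    aeval (∏ i, μ i) (exteriorPower.map k φ).charpoly = 0 := by
  classical
  let L0 : V [⋀^Fin k]→ₗ[ℚ] ℂ :=
    { (((Matrix.detRowAlternating (n := Fin k) (R := ℂ)).toMultilinearMap.restrictScalars
        ℚ).compLinearMap (fun _ => LinearMap.pi l)) with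
      map_eq_zero_of_eq' := by
        intro v i j hij hne
        exact Matrix.det_zero_of_row_eq (M := Matrix.of fun i j => l j (v i)) hne
          (by ext c; simp [hij]) }
  let L := exteriorPower.alternatingMapLinearEquiv L0
  have hL : ∀ v, L (exteriorPower.ιMulti ℚ k v) = (Matrix.of fun i j => l j (v i)).det := fun v =>
    exteriorPower.alternatingMapLinearEquiv_apply_ιMulti L0 v
  set ψ := exteriorPower.map k φ with hψ
  have heq : L ∘ₗ ψ = LinearMap.mulLeft ℚ (∏ i, μ i) ∘ₗ L := by
    apply exteriorPower.linearMap_ext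
    ext v
    simp only [LinearMap.compAlternatingMap_apply, LinearMap.comp_apply, LinearMap.mulLeft_apply, hψ,
      exteriorPower.map_apply_ιMulti, hL, Function.comp_apply, h]
    exact Matrix.det_mul_row μ (Matrix.of fun i j => l j (v i))
  have hpow : ∀ (p : ℚ[X]) x, L (aeval ψ p x) = aeval (∏ i, μ i) p * L x := by
    intro p
    induction p using Polynomial.induction_on' with
    | add p q hp hq => intro x; simp [hp, hq, add_mul]
    | monomial m a =>
      intro x
      have : ∀ (m : ℕ), L ((ψ ^ m) x) = (∏ i, μ i) ^ m * L x := by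
        intro m
        induction m with
        | zero => simp
        | succ m ih =>
          rw [pow_succ', pow_succ', Module.End.mul_apply, mul_assoc, ← ih]
          exact LinearMap.congr_fun heq _
      simp only [aeval_monomial, Module.End.mul_apply, Module.algebraMap_end_apply, map_smul, this]
      rw [Algebra.smul_def, mul_assoc]
  obtain ⟨v, hv⟩ := aux_det l hl
  have hf := hpow ψ.charpoly (exteriorPower.ιMulti ℚ k v)
  rw [LinearMap.aeval_self_charpoly, hL] at hf
  simp only [LinearMap.zero_apply, map_zero] at hf
  exact (mul_eq_zero.1 hf.symm).resolve_right hv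

lemma aux_prod_inj (m : ℕ) (hm : 3 ≤ m) (lam : Fin m → ℂ) (hinj : Function.Injective lam)
    (hgal : galoisActsFully m lam) (I J : Finset (Fin m)) (hc : I.card = J.card)
    (h : ∏ i ∈ I, lam i = ∏ i ∈ J, lam i) : I = J := by
  classical
  let lk : Fin m → splittingFieldOfRoots m lam := fun i =>
    ⟨lam i, root_mem_splittingFieldOfRoots m lam i⟩
  have hg : ∀ τ : Equiv.Perm (Fin m),
      ∃ σ : (splittingFieldOfRoots m lam) ≃ₐ[ℚ] (splittingFieldOfRoots m lam),
        ∀ i, σ (lk i) = lk (τ i) := by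
    intro τ
    obtain ⟨σ, hσ⟩ := hgal τ
    exact ⟨σ, fun i => Subtype.ext (hσ i)⟩
  have hki : Function.Injective lk := fun i j hij => hinj (congrArg Subtype.val hij)
  have hne : ∀ i, lk i ≠ 0 := by
    intro i hi
    obtain ⟨j, hj⟩ : ∃ j, j ≠ i := by
      have : Nontrivial (Fin m) := Fin.nontrivial_iff_two_le.2 (by omega)
      exact exists_ne i
    obtain ⟨σ, hσ⟩ := hg (Equiv.swap i j)
    have h1 := hσ i
    rw [hi, map_zero, Equiv.swap_apply_left] at h1
    exact hj (hki (h1.symm.trans hi.symm))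
  have hk : ∏ i ∈ I, lk i = ∏ i ∈ J, lk i := by
    apply Subtype.ext
    simpa [lk] using h
  by_contra hIJ
  obtain ⟨a, haI, haJ⟩ : ∃ a ∈ I, a ∉ J := by
    by_contra! hsub
    exact hIJ (Finset.eq_of_subset_of_card_le hsub hc.ge)
  obtain ⟨b, hbJ, hbI⟩ : ∃ b ∈ J, b ∉ I := by
    by_contra! hsub
    exact hIJ (Finset.eq_of_subset_of_card_le hsub hc.le).symm
  have hab : a ≠ b := fun e => hbI (e ▸ haI)
  have hsq : lk a ^ 2 = lk b ^ 2 := by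
    obtain ⟨σ, hσ⟩ := hg (Equiv.swap a b)
    have h2 := congrArg σ hk
    rw [map_prod, map_prod] at h2
    simp only [hσ] at h2
    rw [← Finset.mul_prod_erase I _ haI, ← Finset.mul_prod_erase J _ hbJ] at h2 hk
    have e1 : ∏ x ∈ I.erase a, lk (Equiv.swap a b x) = ∏ x ∈ I.erase a, lk x := by
      apply Finset.prod_congr rfl
      intro x hx
      rw [Finset.mem_erase] at hx
      rw [Equiv.swap_apply_of_ne_of_ne hx.1 (fun e : x = b => hbI (e ▸ hx.2))]
    have e2 : ∏ x ∈ J.erase b, lk (Equiv.swap a b x) = ∏ x ∈ J.erase b, lk x := by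
      apply Finset.prod_congr rfl
      intro x hx
      rw [Finset.mem_erase] at hx
      rw [Equiv.swap_apply_of_ne_of_ne (fun e : x = a => haJ (e ▸ hx.2)) hx.1]
    rw [e1, e2, Equiv.swap_apply_left, Equiv.swap_apply_right] at h2
    have hP : ∏ x ∈ I.erase a, lk x ≠ 0 := Finset.prod_ne_zero_iff.2 fun i _ => hne i
    have hQ : ∏ x ∈ J.erase b, lk x ≠ 0 := Finset.prod_ne_zero_iff.2 fun i _ => hne i
    generalize (∏ x ∈ I.erase a, lk x) = P at *
    generalize (∏ x ∈ J.erase b, lk x) = Q at *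
    apply mul_right_cancel₀ (mul_ne_zero hP hQ)
    linear_combination lk a * Q * hk - lk b * Q * h2
  obtain ⟨c, hca, hcb⟩ : ∃ c : Fin m, c ≠ a ∧ c ≠ b := by
    have : ({a, b} : Finset (Fin m)).card < (Finset.univ : Finset (Fin m)).card := by
      rw [Finset.card_pair hab, Finset.card_univ, Fintype.card_fin]; omega
    obtain ⟨c, -, hc⟩ := Finset.exists_mem_notMem_of_card_lt_card this
    simp at hc
    exact ⟨c, hc.1, hc.2⟩
  have hsq2 : lk a ^ 2 = lk c ^ 2 := by
    obtain ⟨σ, hσ⟩ := hg (Equiv.swap b c)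
    have h2 := congrArg σ hsq
    rwa [map_pow, map_pow, hσ, hσ, Equiv.swap_apply_left,
      Equiv.swap_apply_of_ne_of_ne hab hca.symm] at h2
  rcases sq_eq_sq_iff_eq_or_eq_neg.1 hsq with e | e
  · exact hab (hki e)
  rcases sq_eq_sq_iff_eq_or_eq_neg.1 hsq2 with e' | e'
  · exact hca (hki e').symm
  · exact hcb (hki (neg_injective (e'.symm.trans e)))

lemma aux_conj (m : ℕ) (lam : Fin m → ℂ)
    (hgal : galoisActsFully m lam) (I J : Finset (Fin m)) (hc : I.card = J.card)
    (p : ℚ[X]) (h : aeval (∏ i ∈ I, lam i) p = 0) : aeval (∏ i ∈ J, lam i) p = 0 := by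
  classical
  let e : {x // x ∈ I} ≃ {x // x ∈ J} := Finset.equivOfCardEq hc
  have hIJ : I.map e.extendSubtype.toEmbedding = J := by
    apply Finset.eq_of_subset_of_card_le
    · intro x hx
      obtain ⟨y, hy, rfl⟩ := Finset.mem_map.1 hx
      exact e.extendSubtype_mem y hy
    · rw [Finset.card_map, hc]
  obtain ⟨σ, hσ⟩ := hgal e.extendSubtype
  let lk : Fin m → splittingFieldOfRoots m lam := fun i =>
    ⟨lam i, root_mem_splittingFieldOfRoots m lam i⟩
  let f := (splittingFieldOfRoots m lam).val
  have h1 : ∏ i ∈ I, lam i = f (∏ i ∈ I, lk i) := by rw [map_prod]; rfl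
  have h2 : ∏ i ∈ J, lam i = f (σ (∏ i ∈ I, lk i)) := by
    rw [← hIJ, Finset.prod_map, map_prod, map_prod]
    exact Finset.prod_congr rfl fun i _ => (hσ i).symm
  rw [h1, aeval_algHom_apply] at h
  rw [h2, aeval_algHom_apply]
  have h3 : aeval (∏ i ∈ I, lk i) p = 0 := f.toRingHom.injective (h.trans (map_zero _).symm)
  rw [aeval_algHom_apply σ, h3, map_zero, map_zero]

end Aux

/-- Under condition (*), the endomorphism `⋀⁴φ` of `⋀⁴V` acts irreducibly:
the only `ℚ`-subspaces of `⋀²V` invariant under `⋀⁴φ` are `0` and `⋀⁴V`. -/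
theorem extPow_four_irreducible_action
    (n : ℕ) (hn : 4 ≤ n)
    (V : Type) [AddCommGroup V] [Module ℚ V] [FiniteDimensional ℚ V]
    (hdim : Module.finrank ℚ V = 2 * n)
    (φ : V →ₗ[ℚ] V)
    (lam : Fin (2 * n) → ℂ) (hinj : Function.Injective lam)
    (hroot : ∀ i, Polynomial.aeval (lam i) (LinearMap.charpoly φ) = 0)
    (hgal : galoisActsFully (2 * n) lam) :
    ∀ S : Submodule ℚ (ExteriorAlgebra ℚ V), S ≤ ⋀[ℚ]^4 V →
      Submodule.map (ExteriorAlgebra.map φ).toLinearMap S ≤ S →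
      S = ⊥ ∨ S = ⋀[ℚ]^4 V := by
  intro S hS4 hSmap
  classical
  have h4 : Module.finrank ℚ (⋀[ℚ]^4 V) = (2 * n).choose 4 := by
    rw [exteriorPower.finrank_eq, hdim]
  let Z : Finset ℂ := (Finset.powersetCard 4 (Finset.univ : Finset (Fin (2 * n)))).image
    fun I => ∏ i ∈ I, lam i
  have hZ : Z.card = Module.finrank ℚ (⋀[ℚ]^4 V) := by
    rw [h4, Finset.card_image_of_injOn, Finset.card_powersetCard, Finset.card_univ,
      Fintype.card_fin]
    intro I hI J hJ hIJ
    have hI' := (Finset.mem_powersetCard.1 hI).2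
    have hJ' := (Finset.mem_powersetCard.1 hJ).2
    exact aux_prod_inj (2 * n) (by omega) lam hinj hgal I J (hI'.trans hJ'.symm) hIJ
  have hconj : ∀ p : Polynomial ℚ, ∀ z ∈ Z, Polynomial.aeval z p = 0 →
      ∀ w ∈ Z, Polynomial.aeval w p = 0 := by
    intro p z hz hp w hw
    obtain ⟨I, hI, rfl⟩ := Finset.mem_image.1 hz
    obtain ⟨J, hJ, rfl⟩ := Finset.mem_image.1 hw
    have hI' := (Finset.mem_powersetCard.1 hI).2
    have hJ' := (Finset.mem_powersetCard.1 hJ).2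
    exact aux_conj _ lam hgal I J (hI'.trans hJ'.symm) p hp
  choose l hl0 hl using fun i => aux_functional φ (lam i) (hroot i)
  have hind := aux_indep φ lam hinj l hl0 hl
  let c : Fin 4 ↪ Fin (2 * n) := Fin.castLEEmb (by omega)
  have hr0 := aux_wedge φ (lam ∘ c) (l ∘ c) (hind.comp _ c.injective) (fun i v => hl _ v)
  have hr : ∀ z ∈ Z, Polynomial.aeval z (exteriorPower.map 4 φ).charpoly = 0 := by
    refine hconj _ (∏ i ∈ Finset.univ.map c, lam i) ?_ ?_
    · exact Finset.mem_image.2 ⟨_, by simp [Finset.mem_powersetCard], rfl⟩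
    · rw [Finset.prod_map]; exact hr0
  have hcoe : ∀ x : ⋀[ℚ]^4 V,
      ((exteriorPower.map 4 φ x : ⋀[ℚ]^4 V) : ExteriorAlgebra ℚ V) = ExteriorAlgebra.map φ x := by
    intro x
    have : (⋀[ℚ]^4 V).subtype ∘ₗ exteriorPower.map 4 φ =
        (ExteriorAlgebra.map φ).toLinearMap ∘ₗ (⋀[ℚ]^4 V).subtype := by
      apply exteriorPower.linearMap_ext
      ext v
      change ((exteriorPower.map 4 φ (exteriorPower.ιMulti ℚ 4 v) : ⋀[ℚ]^4 V) :
        ExteriorAlgebra ℚ V) = ExteriorAlgebra.map φ (ExteriorAlgebra.ιMulti ℚ 4 v)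
      rw [exteriorPower.map_apply_ιMulti, ExteriorAlgebra.map_apply_ιMulti]
      rfl
    exact LinearMap.congr_fun this x
  have hmain := aux_irred (exteriorPower.map 4 φ) Z hZ hr hconj
    (S.comap (⋀[ℚ]^4 V).subtype) (by
      intro x hx
      rw [Submodule.mem_comap] at hx ⊢
      rw [Submodule.subtype_apply, hcoe x]
      exact hSmap (Submodule.mem_map_of_mem hx))
  rcases hmain with h | h
  · left
    rw [eq_bot_iff]
    intro x hx
    have hx' : (⟨x, hS4 hx⟩ : ⋀[ℚ]^4 V) ∈ S.comap (⋀[ℚ]^4 V).subtype := hx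
    rw [h, Submodule.mem_bot] at hx'
    exact congrArg Subtype.val hx'
  · right
    refine le_antisymm hS4 fun x hx => ?_
    have hx' : (⟨x, hx⟩ : ⋀[ℚ]^4 V) ∈ S.comap (⋀[ℚ]^4 V).subtype := h ▸ Submodule.mem_top
    exact hx'

end VoisinPaper
end
end

section
/- There is no nonzero Hodge class of degree 2: if v ∈ ∧²V is such that the image of 1 ⊗ v in ∧²V_ℂ lies in the (1,1)-component W ∧ c(W), then v = 0. (This is the statement that H²(T,ℚ) carries no nonzero Hodge class for a torus T with an endomorphism satisfying (*).) -/
open scoped TensorProduct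

noncomputable section

namespace VoisinPaper

/-- The `(p, k-p)` Hodge component of `⋀^k (ℂ ⊗ V)` (sitting inside the exterior algebra of
`ℂ ⊗ V`): the `ℂ`-span of wedge products of `p` elements of `W` and `k - p` elements of
`c(W)`; this is the image of `⋀^p W ⊗ ⋀^{k-p} c(W)` under the wedge product. -/
def hodgeComp (V : Type) [AddCommGroup V] [Module ℚ V] (W : Submodule ℂ (ℂ ⊗[ℚ] V))
    (k p : ℕ) : Submodule ℂ (ExteriorAlgebra ℂ (ℂ ⊗[ℚ] V)) :=
  Submodule.span ℂ {x | ∃ v : Fin k → ℂ ⊗[ℚ] V,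
     (∀ i : Fin k, ((i : ℕ) < p → v i ∈ W) ∧ (p ≤ (i : ℕ) → v i ∈ conjSub V W)) ∧
     x = ExteriorAlgebra.ιMulti ℂ k v}

/-- The natural "complexification" morphism from the exterior algebra of `V` over `ℚ` to the
exterior algebra of `ℂ ⊗ V` over `ℂ`; it identifies `⋀^k_ℚ V` with the rational points of
`⋀^k_ℂ (ℂ ⊗ V)`. -/
def thetaA (V : Type) [AddCommGroup V] [Module ℚ V]
    [Algebra ℚ (ExteriorAlgebra ℂ (ℂ ⊗[ℚ] V))]
    [IsScalarTower ℚ ℂ (ExteriorAlgebra ℂ (ℂ ⊗[ℚ] V))] :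
    ExteriorAlgebra ℚ V →ₐ[ℚ] ExteriorAlgebra ℂ (ℂ ⊗[ℚ] V) :=
  ExteriorAlgebra.lift ℚ
    ⟨((ExteriorAlgebra.ι ℂ (M := ℂ ⊗[ℚ] V)).restrictScalars ℚ) ∘ₗ iotaV V,
      fun _ => ExteriorAlgebra.ι_sq_zero _⟩

section helpers

def alt2 {R M L : Type*} [CommRing R] [AddCommGroup M] [Module R M] [CommRing L] [Algebra R L]
    (f g : M →ₗ[R] L) : M [⋀^Fin 2]→ₗ[R] L where
  toFun x := f (x 0) * g (x 1) - f (x 1) * g (x 0)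
  map_update_add' := by
    intro inst m i x y
    rw [Subsingleton.elim inst (instDecidableEqFin 2)]
    fin_cases i <;> simp [Function.update] <;> ring
  map_update_smul' := by
    intro inst m i c x
    rw [Subsingleton.elim inst (instDecidableEqFin 2)]
    fin_cases i <;> simp [Function.update, smul_sub]
  map_eq_zero_of_eq' := by
    intro v i j h hij
    have : v 0 = v 1 := by
      fin_cases i <;> fin_cases j <;> simp_all
    simp [this]

def omega2 {R M L : Type*} [CommRing R] [AddCommGroup M] [Module R M] [CommRing L] [Algebra R L]
    (f g : M →ₗ[R] L) : ExteriorAlgebra R M →ₗ[R] L :=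
  ExteriorAlgebra.liftAlternating (R := R) (M := M) (N := L)
    (fun i => if h : i = 2 then h ▸ alt2 f g else 0)

lemma omega2_ι {R M L : Type*} [CommRing R] [AddCommGroup M] [Module R M] [CommRing L]
    [Algebra R L] (f g : M →ₗ[R] L) (x : Fin 2 → M) :
    omega2 f g (ExteriorAlgebra.ιMulti R 2 x) = f (x 0) * g (x 1) - f (x 1) * g (x 0) := by
  unfold omega2
  rw [ExteriorAlgebra.liftAlternating_apply_ιMulti]
  simp [alt2]

@[elab_as_elim]
lemma ext2_induction {R M : Type*} [CommRing R] [AddCommGroup M] [Module R M]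
    {p : ExteriorAlgebra R M → Prop} {v : ExteriorAlgebra R M} (hv : v ∈ ⋀[R]^2 M)
    (h1 : ∀ x : Fin 2 → M, p (ExteriorAlgebra.ιMulti R 2 x)) (h0 : p 0)
    (ha : ∀ x y, p x → p y → p (x + y)) (hs : ∀ (c : R) x, p x → p (c • x)) : p v := by
  rw [← ExteriorAlgebra.ιMulti_span_fixedDegree] at hv
  induction hv using Submodule.span_induction with
  | mem x h => obtain ⟨y, rfl⟩ := h; exact h1 y
  | zero => exact h0
  | add x y _ _ hx hy => exact ha x y hx hy
  | smul c x _ hx => exact hs c x hx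

lemma omega2_map {V L L' : Type*} [AddCommGroup V] [Module ℚ V] [CommRing L] [Algebra ℚ L]
    [CommRing L'] [Algebra ℚ L'] (s : L →ₐ[ℚ] L') (f g : V →ₗ[ℚ] L)
    {v : ExteriorAlgebra ℚ V} (hv : v ∈ ⋀[ℚ]^2 V) :
    omega2 (s.toLinearMap ∘ₗ f) (s.toLinearMap ∘ₗ g) v = s (omega2 f g v) := by
  refine ext2_induction hv ?_ ?_ ?_ ?_
  · intro x; simp only [omega2_ι]; simp
  · simp
  · intro x y hx hy; simp [hx, hy]
  · intro c x hx; simp [hx]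

lemma omega2_theta (V : Type) [AddCommGroup V] [Module ℚ V]
    [Algebra ℚ (ExteriorAlgebra ℂ (ℂ ⊗[ℚ] V))]
    [IsScalarTower ℚ ℂ (ExteriorAlgebra ℂ (ℂ ⊗[ℚ] V))] (f g : V →ₗ[ℚ] ℂ)
    {v : ExteriorAlgebra ℚ V} (hv : v ∈ ⋀[ℚ]^2 V) :
    omega2 (f.liftBaseChange ℂ) (g.liftBaseChange ℂ) (thetaA V v) = omega2 f g v := by
  refine ext2_induction hv ?_ ?_ ?_ ?_
  · intro x
    have : thetaA V (ExteriorAlgebra.ιMulti ℚ 2 x) =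
        ExteriorAlgebra.ιMulti ℂ 2 (fun i => iotaV V (x i)) := by
      rw [ExteriorAlgebra.ιMulti_apply, ExteriorAlgebra.ιMulti_apply, map_list_prod]
      simp only [List.map_ofFn]
      congr 2
      funext i
      exact ExteriorAlgebra.lift_ι_apply _ _ _ _
    rw [this, omega2_ι, omega2_ι]
    simp [iotaV]
  · simp
  · intro x y hx hy; simp [hx, hy]
  · intro c x hx
    let F : ExteriorAlgebra ℚ V →+ ℂ :=
      (omega2 (f.liftBaseChange ℂ) (g.liftBaseChange ℂ)).toAddMonoidHom.comp
        (thetaA V).toRingHom.toAddMonoidHom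
    have h1 : F (c • x) = c • F x := map_rat_smul F c x
    have h2 : omega2 f g (c • x) = c • omega2 f g x := map_smul _ _ _
    rw [h2, ← hx]
    exact h1

lemma omega2_add_left {V : Type*} [AddCommGroup V] [Module ℚ V] (f f' g : V →ₗ[ℚ] ℂ)
    {v : ExteriorAlgebra ℚ V} (hv : v ∈ ⋀[ℚ]^2 V) :
    omega2 (f + f') g v = omega2 f g v + omega2 f' g v := by
  refine ext2_induction hv ?_ ?_ ?_ ?_
  · intro x; simp only [omega2_ι]; simp; ring
  · simp
  · intro x y hx hy; simp only [map_add, hx, hy]; ring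
  · intro c x hx; simp only [map_smul, hx, smul_add]

lemma omega2_smul_left {V : Type*} [AddCommGroup V] [Module ℚ V] (a : ℂ) (f g : V →ₗ[ℚ] ℂ)
    {v : ExteriorAlgebra ℚ V} (hv : v ∈ ⋀[ℚ]^2 V) :
    omega2 (a • f) g v = a * omega2 f g v := by
  refine ext2_induction hv ?_ ?_ ?_ ?_
  · intro x; simp only [omega2_ι]; simp; ring
  · simp
  · intro x y hx hy; simp only [map_add, hx, hy]; ring
  · intro c x hx; simp only [map_smul, hx, mul_smul_comm]

lemma omega2_swap {V : Type*} [AddCommGroup V] [Module ℚ V] (f g : V →ₗ[ℚ] ℂ)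
    {v : ExteriorAlgebra ℚ V} (hv : v ∈ ⋀[ℚ]^2 V) :
    omega2 f g v = - omega2 g f v := by
  refine ext2_induction hv ?_ ?_ ?_ ?_
  · intro x; simp only [omega2_ι]; simp; ring
  · simp
  · intro x y hx hy; simp only [map_add, hx, hy]; ring
  · intro c x hx; simp only [map_smul, hx, smul_neg]

lemma omega2_span {V : Type*} [AddCommGroup V] [Module ℚ V] {ι : Type*}
    (B : Module.Basis ι ℂ (V →ₗ[ℚ] ℂ)) {v : ExteriorAlgebra ℚ V} (hv : v ∈ ⋀[ℚ]^2 V)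
    (h : ∀ i j, omega2 (B i) (B j) v = 0) (f g : V →ₗ[ℚ] ℂ) : omega2 f g v = 0 := by
  have key : ∀ g : V →ₗ[ℚ] ℂ, (∀ i, omega2 (B i) g v = 0) → ∀ f, omega2 f g v = 0 := by
    intro g hg f
    have hf : f ∈ Submodule.span ℂ (Set.range B) := by rw [B.span_eq]; trivial
    induction hf using Submodule.span_induction with
    | mem x h => obtain ⟨y, rfl⟩ := h; exact hg y
    | zero => simpa using omega2_smul_left 0 0 g hv
    | add x y _ _ hx hy => rw [omega2_add_left _ _ _ hv, hx, hy, add_zero]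
    | smul c x _ hx => rw [omega2_smul_left _ _ _ hv, hx, mul_zero]
  apply key
  intro i
  rw [omega2_swap _ _ hv, neg_eq_zero]
  exact key _ (fun j => h j i) _

lemma omega2_recon {V : Type*} [AddCommGroup V] [Module ℚ V] [FiniteDimensional ℚ V]
    {v : ExteriorAlgebra ℚ V} (hv : v ∈ ⋀[ℚ]^2 V)
    (h : ∀ f g : V →ₗ[ℚ] ℚ, omega2 f g v = 0) : v = 0 := by
  classical
  let b := Module.finBasis ℚ V
  have key : ∑ i, ∑ j, omega2 (b.coord i) (b.coord j) v •
      (ExteriorAlgebra.ι ℚ (b i) * ExteriorAlgebra.ι ℚ (b j)) = (2 : ℚ) • v := by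
    refine ext2_induction hv ?_ ?_ ?_ ?_
    · intro x
      have e : ∀ y z : V, ∑ i, ∑ j, (b.repr y i * b.repr z j) •
          (ExteriorAlgebra.ι ℚ (b i) * ExteriorAlgebra.ι ℚ (b j))
          = ExteriorAlgebra.ι ℚ y * ExteriorAlgebra.ι ℚ z := by
        intro y z
        conv_rhs => rw [← b.sum_repr y, ← b.sum_repr z]
        simp only [map_sum, map_smul, Finset.sum_mul_sum, smul_mul_smul_comm]
      have e2 : ExteriorAlgebra.ι ℚ (x 1) * ExteriorAlgebra.ι ℚ (x 0)
          = - (ExteriorAlgebra.ι ℚ (x 0) * ExteriorAlgebra.ι ℚ (x 1)) :=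
        eq_neg_of_add_eq_zero_left (ExteriorAlgebra.ι_add_mul_swap _ _)
      simp only [omega2_ι, sub_smul, Finset.sum_sub_distrib, Module.Basis.coord_apply]
      rw [e, e, e2]
      simp [ExteriorAlgebra.ιMulti_apply, two_smul, Matrix.vecTail]
    · simp
    · intro x y hx hy
      simp only [map_add, add_smul, Finset.sum_add_distrib, hx, hy, smul_add]
    · intro c x hx
      simp only [map_smul, smul_assoc, ← Finset.smul_sum, hx]
      rw [smul_comm]
  simp only [h, zero_smul, Finset.sum_const_zero] at key
  simpa using key.symm

lemma omega2_recon' {V : Type*} [AddCommGroup V] [Module ℚ V] [FiniteDimensional ℚ V]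
    {v : ExteriorAlgebra ℚ V} (hv : v ∈ ⋀[ℚ]^2 V)
    (h : ∀ f g : V →ₗ[ℚ] ℂ, omega2 f g v = 0) : v = 0 := by
  refine omega2_recon hv fun f g => ?_
  have := h ((Algebra.ofId ℚ ℂ).toLinearMap ∘ₗ f) ((Algebra.ofId ℚ ℂ).toLinearMap ∘ₗ g)
  rw [omega2_map _ _ _ hv] at this
  exact (map_eq_zero _).1 this

lemma exists_eigenfunctional {V K : Type*} [AddCommGroup V] [Module ℚ V] [FiniteDimensional ℚ V]
    [Field K] [Algebra ℚ K] (φ : V →ₗ[ℚ] V) (μ : K)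
    (h : Polynomial.aeval μ (LinearMap.charpoly φ) = 0) :
    ∃ l : V →ₗ[ℚ] K, l ≠ 0 ∧ ∀ x, l (φ x) = μ * l x := by
  classical
  let b := Module.finBasis ℚ V
  let M := LinearMap.toMatrix b b φ
  have hdet : (Matrix.scalar _ μ - M.map (algebraMap ℚ K)).det = 0 := by
    rw [← Matrix.eval_charpoly, Matrix.charpoly_map, LinearMap.charpoly_toMatrix,
      Polynomial.eval_map_algebraMap, h]
  obtain ⟨w, hw0, hw⟩ := Matrix.exists_vecMul_eq_zero_iff.2 hdet
  have hc : ∀ j, b.constr ℚ w (b j) = w j := fun j => b.constr_basis ℚ w j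
  refine ⟨b.constr ℚ w, ?_, ?_⟩
  · intro h0
    apply hw0
    ext j
    rw [← hc, h0]; rfl
  · have : b.constr ℚ w ∘ₗ φ = LinearMap.mulLeft ℚ μ ∘ₗ b.constr ℚ w := by
      apply b.ext
      intro j
      have h2 := congrFun hw j
      rw [Matrix.vecMul_sub, Pi.sub_apply, Pi.zero_apply, sub_eq_zero] at h2
      have h3 : φ (b j) = ∑ i, M i j • b i := by
        conv_lhs => rw [← b.sum_repr (φ (b j))]
        simp [M, LinearMap.toMatrix_apply]
      simp only [LinearMap.comp_apply, LinearMap.mulLeft_apply]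
      rw [h3, map_sum, hc]
      simp only [map_smul, hc]
      simp [Matrix.vecMul, dotProduct, Matrix.diagonal_apply] at h2
      rw [mul_comm, h2]
      refine Finset.sum_congr rfl fun i _ => ?_
      rw [Algebra.smul_def, mul_comm]; simp
    intro x
    exact LinearMap.congr_fun this x

/-- Precomposition with `φ`. -/
def preT {V : Type*} [AddCommGroup V] [Module ℚ V] (φ : V →ₗ[ℚ] V) :
    Module.End ℂ (V →ₗ[ℚ] ℂ) where
  toFun l := l ∘ₗ φ
  map_add' _ _ := rfl
  map_smul' _ _ := rfl

lemma exists_two {D : Type*} [AddCommGroup D] [Module ℂ D] {m : ℕ}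
    (T : Module.End ℂ D) (lam : Fin m → ℂ) (hinj : Function.Injective lam)
    (B : Module.Basis (Fin m) ℂ D) (hB : ∀ i, T (B i) = lam i • B i)
    (A : Submodule ℂ D) (hA : ∀ a ∈ A, T a ∈ A) (hd : 2 ≤ Module.finrank ℂ A) :
    ∃ i j, i ≠ j ∧ B i ∈ A ∧ B j ∈ A := by
  classical
  have hBv : ∀ i, T.HasEigenvector (lam i) (B i) := fun i =>
    ⟨Module.End.mem_eigenspace_iff.2 (hB i), B.ne_zero i⟩
  have hpoly : ∀ (q : Polynomial ℂ), ∀ a ∈ A, Polynomial.aeval T q a ∈ A := by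
    intro q a ha
    induction q using Polynomial.induction_on' generalizing a with
    | add p q hp hq => rw [map_add]; exact A.add_mem (hp a ha) (hq a ha)
    | monomial k c =>
      rw [Polynomial.aeval_monomial]
      refine A.smul_mem c ?_
      induction k with
      | zero => simpa using ha
      | succ k ih => rw [pow_succ']; exact hA _ ih
  have h1 : ∀ a ∈ A, ∀ i, B.repr a i ≠ 0 → B i ∈ A := by
    intro a ha i hi
    let q : Polynomial ℂ := ∏ j ∈ Finset.univ.erase i, (Polynomial.X - Polynomial.C (lam j))
    have hq0 : ∀ j, j ≠ i → q.eval (lam j) = 0 := by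
      intro j hj
      rw [Polynomial.eval_prod]
      exact Finset.prod_eq_zero (Finset.mem_erase.2 ⟨hj, Finset.mem_univ j⟩) (by simp)
    have hqi : q.eval (lam i) ≠ 0 := by
      rw [Polynomial.eval_prod, Finset.prod_ne_zero_iff]
      intro j hj
      simp only [Polynomial.eval_sub, Polynomial.eval_X, Polynomial.eval_C, sub_ne_zero]
      exact fun h => (Finset.ne_of_mem_erase hj) (hinj h).symm
    have : Polynomial.aeval T q a = (B.repr a i * q.eval (lam i)) • B i := by
      conv_lhs => rw [← B.sum_repr a]
      rw [map_sum, Finset.sum_eq_single i]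
      · rw [map_smul, Module.End.aeval_apply_of_hasEigenvector (hBv i), smul_smul]
      · intro j _ hj
        rw [map_smul, Module.End.aeval_apply_of_hasEigenvector (hBv j), hq0 j hj]
        simp
      · simp
    have h2 := hpoly q a ha
    rw [this] at h2
    exact (A.smul_mem_iff (mul_ne_zero hi hqi)).1 h2
  let S : Finset (Fin m) := Finset.univ.filter fun i => B i ∈ A
  have hle : A ≤ Submodule.span ℂ ((S.image B : Finset D) : Set D) := by
    intro a ha
    rw [← B.sum_repr a]
    refine Submodule.sum_mem _ fun i _ => ?_
    by_cases hi : B.repr a i = 0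
    · simp [hi]
    · refine Submodule.smul_mem _ _ (Submodule.subset_span ?_)
      simp only [Finset.coe_image]
      exact ⟨i, by simpa [S] using h1 a ha i hi, rfl⟩
  have hfin : Module.finrank ℂ A ≤ S.card :=
    (Submodule.finrank_mono hle).trans ((finrank_span_finset_le_card _).trans Finset.card_image_le)
  obtain ⟨i, hi, j, hj, hij⟩ := Finset.one_lt_card.1 (show 1 < S.card by omega)
  exact ⟨i, j, hij, by simpa [S] using hi, by simpa [S] using hj⟩

lemma eig_unique {D : Type*} [AddCommGroup D] [Module ℂ D] {m : ℕ}
    (T : Module.End ℂ D) (lam : Fin m → ℂ) (hinj : Function.Injective lam)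
    (B : Module.Basis (Fin m) ℂ D) (hB : ∀ i, T (B i) = lam i • B i)
    (i : Fin m) (d : D) (hd : T d = lam i • d) : ∃ c : ℂ, d = c • B i := by
  refine ⟨B.repr d i, ?_⟩
  have h : ∀ j, B.repr (T d) j = lam j * B.repr d j := by
    intro j
    have h0 : T d = ∑ k, (B.repr d k * lam k) • B k := by
      conv_lhs => rw [← B.sum_repr d]
      simp only [map_sum, map_smul, hB, smul_smul]
    rw [h0, B.repr_sum_self, mul_comm]
  conv_lhs => rw [← B.sum_repr d]
  rw [Finset.sum_eq_single i]
  · intro j _ hj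
    have := h j
    rw [hd] at this
    simp only [map_smul, Finsupp.smul_apply, smul_eq_mul] at this
    have h2 : B.repr d j = 0 := by
      by_contra h3
      exact hj (hinj (mul_right_cancel₀ h3 this)).symm
    simp [h2]
  · simp

end helpers

/-- In the situation of a `2n`-dimensional `ℚ`-vector space `V` (`n ≥ 4`) with
an endomorphism `φ` satisfying condition (*), and a subspace `W ⊆ ℂ ⊗ V` of dimension `n`,
invariant under `φ_ℂ`, with `ℂ ⊗ V = W ⊕ c(W)`, there is no nonzero Hodge class of degree 2:
if `v ∈ ⋀²V` has image in the `(1,1)`-component `W ∧ c(W)` of `⋀²(ℂ ⊗ V)`, then `v = 0`. -/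
theorem no_nonzero_hodge_class_degree_two
    (n : ℕ) (hn : 4 ≤ n)
    (V : Type) [AddCommGroup V] [Module ℚ V] [FiniteDimensional ℚ V]
    (hdim : Module.finrank ℚ V = 2 * n)
    (φ : V →ₗ[ℚ] V)
    (lam : Fin (2 * n) → ℂ) (hinj : Function.Injective lam)
    (hroot : ∀ i, Polynomial.aeval (lam i) (LinearMap.charpoly φ) = 0)
    (hgal : galoisActsFully (2 * n) lam)
    (W : Submodule ℂ (ℂ ⊗[ℚ] V))
    (hWdim : Module.finrank ℂ W = n)
    (hWinv : ∀ x ∈ W, LinearMap.baseChange ℂ φ x ∈ W)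
    (hWsup : W.restrictScalars ℚ ⊔ conjSub V W = ⊤)
    (hWinf : W.restrictScalars ℚ ⊓ conjSub V W = ⊥)
    [Algebra ℚ (ExteriorAlgebra ℂ (ℂ ⊗[ℚ] V))]
    [IsScalarTower ℚ ℂ (ExteriorAlgebra ℂ (ℂ ⊗[ℚ] V))] :
    ∀ v ∈ ⋀[ℚ]^2 V, thetaA V v ∈ hodgeComp V W 2 1 → v = 0 := by
  intro v hv hH
  classical
  let K := splittingFieldOfRoots (2 * n) lam
  let μ : Fin (2 * n) → K := fun i => ⟨lam i, root_mem_splittingFieldOfRoots _ lam i⟩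
  have hex : ∀ i, ∃ l : V →ₗ[ℚ] K, l ≠ 0 ∧ ∀ x, l (φ x) = μ i * l x := by
    intro i
    apply exists_eigenfunctional
    apply K.val.injective
    rw [map_zero, ← hroot i]
    exact (Polynomial.aeval_algHom_apply K.val (μ i) _).symm
  choose l hl0 hl using hex
  let L : Fin (2 * n) → (V →ₗ[ℚ] ℂ) := fun i => K.val.toLinearMap ∘ₗ l i
  let T := preT φ
  have hLT : ∀ i, T (L i) = lam i • L i := by
    intro i
    ext x
    change ((l i (φ x) : K) : ℂ) = lam i * ((l i x : K) : ℂ)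
    rw [hl]; rfl
  have hL0 : ∀ i, L i ≠ 0 := by
    intro i h
    apply hl0 i
    ext x
    exact congrFun (congrArg DFunLike.coe h) x
  have hli : LinearIndependent ℂ L :=
    Module.End.eigenvectors_linearIndependent' T lam hinj L
      fun i => ⟨Module.End.mem_eigenspace_iff.2 (hLT i), hL0 i⟩
  have hfr : Module.finrank ℂ (ℂ ⊗[ℚ] V) = 2 * n := by
    rw [Module.finrank_baseChange, hdim]
  let E : (V →ₗ[ℚ] ℂ) ≃ₗ[ℂ] Module.Dual ℂ (ℂ ⊗[ℚ] V) := LinearMap.liftBaseChangeEquiv ℂ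
  have hD : Module.finrank ℂ (V →ₗ[ℚ] ℂ) = 2 * n := by
    rw [E.finrank_eq, Subspace.dual_finrank_eq, hfr]
  have : Nonempty (Fin (2 * n)) := ⟨⟨0, by omega⟩⟩
  let B : Module.Basis (Fin (2 * n)) ℂ (V →ₗ[ℚ] ℂ) :=
    basisOfLinearIndependentOfCardEqFinrank hli (by rw [hD, Fintype.card_fin])
  have hBL : ∀ i, B i = L i := fun i => by simp [B]
  have hBT : ∀ i, T (B i) = lam i • B i := fun i => by rw [hBL]; exact hLT i
  let A : Submodule ℂ (V →ₗ[ℚ] ℂ) := W.dualAnnihilator.comap E.toLinearMap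
  have hAmem : ∀ f, f ∈ A ↔ ∀ w ∈ W, f.liftBaseChange ℂ w = 0 := by
    intro f
    exact Submodule.mem_dualAnnihilator _
  have hAd : Module.finrank ℂ A = n := by
    have h1 := Subspace.finrank_add_finrank_dualAnnihilator_eq W
    have h2 : Module.finrank ℂ A = Module.finrank ℂ W.dualAnnihilator :=
      (E.submoduleMap A).finrank_eq.trans (by
        rw [show Submodule.map (E : (V →ₗ[ℚ] ℂ) →ₗ[ℂ] _) A = W.dualAnnihilator from
          Submodule.map_comap_eq_of_surjective E.surjective _])
    omega
  have hAT : ∀ a ∈ A, T a ∈ A := by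
    intro a ha
    rw [hAmem] at ha ⊢
    intro w hw
    have : (T a).liftBaseChange ℂ = a.liftBaseChange ℂ ∘ₗ LinearMap.baseChange ℂ φ := by
      ext x
      simp [T, preT]
    rw [this]
    exact ha _ (hWinv w hw)
  obtain ⟨i₀, j₀, hij₀, hi₀, hj₀⟩ := exists_two T lam hinj B hBT A hAT (by omega)
  have hzero : omega2 (B i₀) (B j₀) v = 0 := by
    rw [← omega2_theta V _ _ hv]
    rw [hAmem] at hi₀ hj₀
    unfold hodgeComp at hH
    generalize thetaA V v = t at hH
    induction hH using Submodule.span_induction with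
    | mem x h =>
      obtain ⟨y, hy, rfl⟩ := h
      rw [omega2_ι]
      have hy0 := (hy 0).1 (by simp)
      rw [hi₀ _ hy0, hj₀ _ hy0]
      simp
    | zero => simp
    | add x y _ _ hx hy => rw [map_add, hx, hy, add_zero]
    | smul c x _ hx => rw [map_smul, hx, smul_zero]
  have hall : ∀ i j, omega2 (B i) (B j) v = 0 := by
    intro i j
    by_cases hij : i = j
    · subst hij
      have := omega2_swap (B i) (B i) hv
      exact self_eq_neg.1 this
    obtain ⟨τ, hτi, hτj⟩ : ∃ τ : Equiv.Perm (Fin (2 * n)), τ i = i₀ ∧ τ j = j₀ := by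
      refine ⟨Equiv.swap i i₀ * Equiv.swap j (Equiv.swap i i₀ j₀), ?_, ?_⟩
      · have h1 : i ≠ Equiv.swap i i₀ j₀ := by
          intro h
          have := congrArg (Equiv.swap i i₀) h
          rw [Equiv.swap_apply_left, Equiv.swap_apply_self] at this
          exact hij₀ this
        simp [Equiv.swap_apply_of_ne_of_ne hij h1]
      · simp
    obtain ⟨σ, hσ⟩ := hgal τ
    let s : K →ₐ[ℚ] K := σ.toAlgHom
    have hσe : ∀ i, ∃ c : ℂ, K.val.toLinearMap ∘ₗ (s.toLinearMap ∘ₗ l i)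
        = c • B (τ i) := by
      intro i
      apply eig_unique T lam hinj B hBT
      ext x
      change ((σ (l i (φ x)) : K) : ℂ) = lam (τ i) * ((σ (l i x) : K) : ℂ)
      rw [hl, map_mul, ← hσ i]; rfl
    obtain ⟨c, hc⟩ := hσe i
    obtain ⟨d, hd⟩ := hσe j
    rw [hτi] at hc
    rw [hτj] at hd
    have h0 : omega2 (K.val.toLinearMap ∘ₗ (s.toLinearMap ∘ₗ l i))
        (K.val.toLinearMap ∘ₗ (s.toLinearMap ∘ₗ l j)) v = 0 := by
      rw [hc, hd, omega2_smul_left _ _ _ hv, omega2_swap _ _ hv, omega2_smul_left _ _ _ hv,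
        omega2_swap _ _ hv, hzero]
      simp
    rw [omega2_map _ _ _ hv] at h0
    have hh := omega2_map s (l i) (l j) hv
    have h0' : K.val (s (omega2 (l i) (l j) v)) = 0 := (congrArg K.val hh.symm).trans h0
    have h1 : omega2 (l i) (l j) v = 0 := by
      apply σ.injective
      apply K.val.injective
      rw [map_zero, map_zero]
      exact h0'
    rw [hBL, hBL]
    change omega2 (K.val.toLinearMap ∘ₗ l i) (K.val.toLinearMap ∘ₗ l j) v = 0
    rw [omega2_map _ _ _ hv]
    exact (congrArg K.val h1).trans (map_zero _)
  exact omega2_recon' hv (omega2_span B hv hall)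

end VoisinPaper
end
end

section
/- ∧⁴V contains no nonzero sub-Hodge structure of Hodge level ≤ 2: if N ⊆ ∧⁴V is a ℚ-subspace such that ℂ ⊗ N is the direct sum over p+q=4 of its intersections with the (p,q)-components of ∧⁴V_ℂ, and moreover (ℂ ⊗ N) ∩ ∧⁴W = 0 and (ℂ ⊗ N) ∩ ∧⁴c(W) = 0, then N = 0. (This is Lemma 'leirred4' of the paper for A⁴₁ = ∧⁴H¹(T,ℚ).) -/
open scoped TensorProduct

noncomputable section

namespace VoisinPaper

lemma exists_extend_aut (K : IntermediateField ℚ ℂ) (σ : K ≃ₐ[ℚ] K) :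
    ∃ g : ℂ ≃+* ℂ, ∀ x : K, g (x : ℂ) = (σ x : ℂ) := by
  obtain ⟨s, hs⟩ := exists_isTranscendenceBasis K ℂ
  have _i := IsAlgClosed.isAlgClosure_of_transcendence_basis _ hs
  let e : Algebra.adjoin K (Set.range ((↑) : s → ℂ)) ≃+*
      Algebra.adjoin K (Set.range ((↑) : s → ℂ)) :=
    (hs.1.aevalEquiv.symm.toRingEquiv.trans (MvPolynomial.mapEquiv _ σ.toRingEquiv)).trans
      hs.1.aevalEquiv.toRingEquiv
  refine ⟨IsAlgClosure.equivOfEquiv ℂ ℂ e, fun x => ?_⟩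
  have h := IsAlgClosure.equivOfEquiv_algebraMap ℂ ℂ e (algebraMap K _ x)
  have he : e (algebraMap K _ x) = algebraMap K _ (σ x) := by
    simp only [e, RingEquiv.trans_apply]
    have h1 : hs.1.aevalEquiv.symm.toRingEquiv (algebraMap K _ x) = algebraMap K _ x :=
      hs.1.aevalEquiv.symm.commutes x
    rw [h1]
    have h2 : (MvPolynomial.mapEquiv s σ.toRingEquiv) (algebraMap K _ x)
        = algebraMap K (MvPolynomial s K) (σ x) := by
      simp [MvPolynomial.algebraMap_eq]
    rw [h2]
    exact hs.1.aevalEquiv.commutes (σ x)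
  rw [he] at h
  exact h

lemma exists_ring_lift {X : Type} [AddCommGroup X] [Module ℂ X] {A : Type} [Ring A]
    (f : ℂ →+* A) (hf : ∀ c x, f c * x = x * f c) (h : X →+ A)
    (hh : ∀ (c : ℂ) x, h (c • x) = f c * h x) (hsq : ∀ x, h x * h x = 0) :
    ∃ s : ExteriorAlgebra ℂ X →+* A, (∀ c, s (algebraMap ℂ _ c) = f c) ∧
      ∀ x, s (ExteriorAlgebra.ι ℂ x) = h x := by
  let _ : Algebra ℂ A := f.toAlgebra' hf
  let l : X →ₗ[ℂ] A :=
    { toFun := h, map_add' := h.map_add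
      map_smul' := fun c x => by simp only [hh, RingHom.id_apply]; rw [Algebra.smul_def]; rfl }
  refine ⟨(ExteriorAlgebra.lift ℂ ⟨l, hsq⟩).toRingHom, fun c => ?_, fun x => ?_⟩
  · exact (ExteriorAlgebra.lift ℂ ⟨l, hsq⟩).commutes c
  · exact ExteriorAlgebra.lift_ι_apply ℂ l hsq x

lemma exists_semilin {X : Type} [AddCommGroup X] [Module ℂ X] (g : ℂ →+* ℂ) (t : X →+ X)
    (ht : ∀ (c : ℂ) x, t (c • x) = g c • t x) :
    ∃ s : ExteriorAlgebra ℂ X →+* ExteriorAlgebra ℂ X,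
      (∀ c, s (algebraMap ℂ _ c) = algebraMap ℂ _ (g c)) ∧
      (∀ x, s (ExteriorAlgebra.ι ℂ x) = ExteriorAlgebra.ι ℂ (t x)) ∧
      (∀ (c : ℂ) x, s (c • x) = g c • s x) ∧
      ∀ (k : ℕ) (v : Fin k → X), s (ExteriorAlgebra.ιMulti ℂ k v) =
        ExteriorAlgebra.ιMulti ℂ k (t ∘ v) := by
  obtain ⟨s, h1, h2⟩ := exists_ring_lift (X := X) ((algebraMap ℂ (ExteriorAlgebra ℂ X)).comp g)
    (fun c x => Algebra.commutes (g c) x)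
    ((ExteriorAlgebra.ι ℂ (M := X)).toAddMonoidHom.comp t)
    (fun c x => by simp [ht, Algebra.smul_def])
    (fun x => by simp)
  refine ⟨s, h1, h2, fun c x => ?_, fun k v => ?_⟩
  · rw [Algebra.smul_def, map_mul, h1, Algebra.smul_def]; rfl
  · rw [ExteriorAlgebra.ιMulti_apply, ExteriorAlgebra.ιMulti_apply, map_list_prod, List.map_ofFn]
    congr 2
    funext i
    exact h2 _

lemma eigen_minimal {X ι : Type} [AddCommGroup X] [Module ℂ X] [Fintype ι] [DecidableEq ι]
    (e : ι → X) (M : Submodule ℂ X) {T : Type} (G : T → X →ₗ[ℂ] X) (hD : ∀ g, ∀ x ∈ M, G g x ∈ M)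
    (χ : T → ι → ℂ) (hχ : ∀ g, ∀ i, G g (e i) = χ g i • e i)
    (hsep : ∀ i j, i ≠ j → ∃ g, χ g i ≠ χ g j) :
    ∀ (k : ℕ) (F : Finset ι) (c : ι → ℂ), F.card = k → ∑ i ∈ F, c i • e i ∈ M →
      ∑ i ∈ F, c i • e i ≠ 0 → ∃ i, e i ∈ M := by
  intro k
  induction k with
  | zero =>
    intro F c hF h1 h2
    rw [Finset.card_eq_zero] at hF
    subst hF
    simp at h2
  | succ k ih =>
    intro F c hF h1 h2
    have key : ∀ i ∈ F, ∀ g, G g (∑ i ∈ F, c i • e i) ≠ χ g i • (∑ i ∈ F, c i • e i) →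
        ∃ i, e i ∈ M := by
      intro i hi g hne
      have : ∑ j ∈ F.erase i, ((χ g j - χ g i) * c j) • e j =
          G g (∑ i ∈ F, c i • e i) - χ g i • (∑ i ∈ F, c i • e i) := by
        rw [Finset.sum_erase _ (by simp), map_sum, Finset.smul_sum, ← Finset.sum_sub_distrib]
        refine Finset.sum_congr rfl fun j _ => ?_
        rw [map_smul, hχ g, smul_smul, smul_smul, ← sub_smul]
        ring_nf
      refine ih (F.erase i) (fun j => (χ g j - χ g i) * c j) ?_ ?_ ?_
      · rw [Finset.card_erase_of_mem hi, hF]; rfl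
      · rw [this]; exact M.sub_mem (hD g _ h1) (M.smul_mem _ h1)
      · rw [this]; exact sub_ne_zero.2 hne
    by_cases hone : ∃ i ∈ F, ∃ j ∈ F, i ≠ j
    · obtain ⟨i, hi, j, hj, hij⟩ := hone
      obtain ⟨g, hne⟩ := hsep i j hij
      by_cases ha : G g (∑ i ∈ F, c i • e i) = χ g i • (∑ i ∈ F, c i • e i)
      · refine key j hj g fun hb => ?_
        rw [ha, ← sub_eq_zero, ← sub_smul, smul_eq_zero] at hb
        rcases hb with hb | hb
        · exact hne (sub_eq_zero.1 hb)
        · exact h2 hb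
      · exact key i hi g ha
    · push Not at hone
      have hpos : F.Nonempty := by rw [← Finset.card_pos]; omega
      obtain ⟨i, hi⟩ := hpos
      have hFi : F = {i} := Finset.eq_singleton_iff_unique_mem.2 ⟨hi, fun j hj => hone j hj i hi⟩
      subst hFi
      rw [Finset.sum_singleton] at h1 h2
      have hc : c i ≠ 0 := fun h => h2 (by rw [h, zero_smul])
      exact ⟨i, (M.smul_mem_iff hc).1 h1⟩

lemma exists_perm_sep {m : ℕ} (d : Fin m → ℂ) (hd : ∀ i, d i = 1 ∨ d i = 2)
    (a : Fin m) (ha : d a = 2) (c : Fin m) (hc : d c = 1) (I J : Finset (Fin m))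
    (i : Fin m) (hi : i ∈ I) (hiJ : i ∉ J) (j : Fin m) (hj : j ∈ J) (hjI : j ∉ I) :
    ∃ τ : Equiv.Perm (Fin m), ∏ x ∈ I, d (τ x) ≠ ∏ x ∈ J, d (τ x) := by
  have hij : i ≠ j := fun h => hiJ (h ▸ hj)
  have hac : a ≠ c := by rintro rfl; rw [ha] at hc; norm_num at hc
  obtain ⟨τ, hτi, hτj⟩ : ∃ τ : Equiv.Perm (Fin m), τ i = a ∧ τ j = c := by
    refine ⟨Equiv.swap (Equiv.swap i a j) c * Equiv.swap i a, ?_, ?_⟩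
    · simp only [Equiv.Perm.mul_apply, Equiv.swap_apply_left]
      refine Equiv.swap_apply_of_ne_of_ne ?_ hac
      intro h
      have : Equiv.swap i a i = Equiv.swap i a j := by simpa using h
      exact hij ((Equiv.swap i a).injective this)
    · simp
  by_contra! hall
  have h1 := hall τ
  have h2 := hall (τ * Equiv.swap i j)
  have hI : ∀ x ∈ I.erase i, d ((τ * Equiv.swap i j) x) = d (τ x) := by
    intro x hx
    rw [Equiv.Perm.mul_apply, Equiv.swap_apply_of_ne_of_ne (Finset.ne_of_mem_erase hx)]
    rintro rfl; exact hjI (Finset.mem_of_mem_erase hx)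
  have hJ : ∀ x ∈ J.erase j, d ((τ * Equiv.swap i j) x) = d (τ x) := by
    intro x hx
    rw [Equiv.Perm.mul_apply, Equiv.swap_apply_of_ne_of_ne _ (Finset.ne_of_mem_erase hx)]
    rintro rfl; exact hiJ (Finset.mem_of_mem_erase hx)
  rw [← Finset.mul_prod_erase I _ hi, ← Finset.mul_prod_erase J _ hj] at h1 h2
  rw [Finset.prod_congr rfl hI, Finset.prod_congr rfl hJ] at h2
  simp only [Equiv.Perm.mul_apply, Equiv.swap_apply_left, Equiv.swap_apply_right, hτi, hτj,
    ha, hc] at h1 h2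
  have hP : ∏ x ∈ I.erase i, d (τ x) ≠ 0 := by
    rw [Finset.prod_ne_zero_iff]
    intro x _
    rcases hd (τ x) with h | h <;> rw [h] <;> norm_num
  apply hP
  linear_combination (2/3) * h1 - (1/3) * h2

/-- diagonal scaling. -/
def scal {X : Type} [AddCommGroup X] [Module ℂ X] {m : ℕ} (b : Module.Basis (Fin m) ℂ X)
    (d : Fin m → ℂ) : X →ₗ[ℂ] X :=
  b.constr ℂ fun i => d i • b i

lemma scal_basis {X : Type} [AddCommGroup X] [Module ℂ X] {m : ℕ} (b : Module.Basis (Fin m) ℂ X)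
    (d : Fin m → ℂ) (i : Fin m) : scal b d (b i) = d i • b i := by
  simp [scal]

lemma scal_multi {X : Type} [AddCommGroup X] [Module ℂ X] (g : X →ₗ[ℂ] X) (k : ℕ)
    (v : Fin k → X) (c : Fin k → ℂ) (h : ∀ i, g (v i) = c i • v i) :
    ExteriorAlgebra.map g (ExteriorAlgebra.ιMulti ℂ k v) =
      (∏ i, c i) • ExteriorAlgebra.ιMulti ℂ k v := by
  rw [ExteriorAlgebra.map_apply_ιMulti, ← AlternatingMap.map_smul_univ]
  congr 1
  funext i
  exact h i

/-- The core argument. -/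
lemma core {X : Type} [AddCommGroup X] [Module ℂ X] {m : ℕ} (b : Module.Basis (Fin m) ℂ X)
    (M : Submodule ℂ (ExteriorAlgebra ℂ X)) (hM : M ≤ ⋀[ℂ]^4 X) (hM0 : M ≠ ⊥)
    (d : Fin m → ℂ) (hd : ∀ i, d i = 1 ∨ d i = 2)
    (a : Fin m) (ha : d a = 2) (c : Fin m) (hc : d c = 1)
    (hstab : ∀ τ : Equiv.Perm (Fin m), ∀ x ∈ M, ExteriorAlgebra.map (scal b (d ∘ τ)) x ∈ M) :
    ∃ f : Fin 4 ↪ Fin m, ExteriorAlgebra.ιMulti ℂ 4 (b ∘ f) ∈ M := by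
  classical
  obtain ⟨x, hx, hx0⟩ := Submodule.exists_mem_ne_zero_of_ne_bot hM0
  have hs := hM hx
  rw [← exteriorPower.ιMulti_family_span_fixedDegree_of_span ℂ (n := 4) b.span_eq] at hs
  rw [Submodule.mem_span_range_iff_exists_fun] at hs
  obtain ⟨co, hco⟩ := hs
  have hprod : ∀ (I : Set.powersetCard (Fin m) 4) (h : Fin m → ℂ),
      ∏ k, h (Set.powersetCard.ofFinEmbEquiv.symm I k) = ∏ x ∈ (I : Finset (Fin m)), h x := by
    intro I h
    refine Eq.trans (Finset.prod_map Finset.univ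
      (Set.powersetCard.ofFinEmbEquiv.symm I).toEmbedding h).symm ?_
    congr 1
    ext x
    have := Set.powersetCard.mem_range_ofFinEmbEquiv_symm_iff_mem I x
    rw [Finset.mem_map]
    constructor
    · rintro ⟨k, _, hk⟩
      exact this.1 ⟨k, hk⟩
    · intro hx
      obtain ⟨k, hk⟩ := this.2 hx
      exact ⟨k, Finset.mem_univ _, hk⟩
  obtain ⟨I, hI⟩ := eigen_minimal (fun I : Set.powersetCard (Fin m) 4 =>
      ExteriorAlgebra.ιMulti_family ℂ 4 b I) M
    (fun τ : Equiv.Perm (Fin m) => (ExteriorAlgebra.map (scal b (d ∘ τ))).toLinearMap)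
    (fun τ x hx => hstab τ x hx)
    (fun τ I => ∏ k, d (τ (Set.powersetCard.ofFinEmbEquiv.symm I k)))
    (fun τ I => scal_multi (scal b (d ∘ τ)) 4 (b ∘ Set.powersetCard.ofFinEmbEquiv.symm I)
      (fun k => d (τ (Set.powersetCard.ofFinEmbEquiv.symm I k))) fun k => scal_basis b _ _)
    (by
      intro I J hIJ
      obtain ⟨i, hi, hiJ⟩ := (Set.powersetCard.exists_mem_notMem_iff_ne I J).mp hIJ
      obtain ⟨j, hj, hjI⟩ := (Set.powersetCard.exists_mem_notMem_iff_ne J I).mp hIJ.symm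
      obtain ⟨τ, hτ⟩ := exists_perm_sep d hd a ha c hc I J i hi hiJ j hj hjI
      refine ⟨τ, ?_⟩
      rw [hprod I (fun x => d (τ x)), hprod J (fun x => d (τ x))]
      exact hτ) _ Finset.univ co rfl (by rw [hco]; exact hx) (by rw [hco]; exact hx0)
  exact ⟨(Set.powersetCard.ofFinEmbEquiv.symm I).toEmbedding, hI⟩

lemma iMulti_ne_zero {X : Type} [AddCommGroup X] [Module ℂ X] {m : ℕ}
    (b : Module.Basis (Fin m) ℂ X) (f : Fin 4 ↪ Fin m) :
    ExteriorAlgebra.ιMulti ℂ 4 (b ∘ f) ≠ 0 := by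
  obtain ⟨f0⟩ : Nonempty (Fin 4 ↪o Fin m) := by
    have : 4 ≤ m := by simpa using Fintype.card_le_of_embedding f
    exact ⟨Fin.castLEOrderEmb this⟩
  obtain ⟨τ, hτ⟩ := Equiv.Perm.exists_smul_eq_embedding f0.toEmbedding f
  have h := ((b.reindex τ.symm).exteriorPower 4).ne_zero (Set.powersetCard.ofFinEmbEquiv f0)
  rw [exteriorPower.basis_apply] at h
  intro h0
  apply h
  apply Subtype.ext
  rw [exteriorPower.ιMulti_family_apply_coe]
  simp only [ExteriorAlgebra.ιMulti_family, Equiv.symm_apply_apply]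
  rw [← hτ] at h0
  refine Eq.trans ?_ h0
  congr 1
  funext k
  simp

lemma exists_perm_into {m : ℕ} (S : Finset (Fin m)) (hS : 4 ≤ S.card) (f : Fin 4 ↪ Fin m) :
    ∃ τ : Equiv.Perm (Fin m), ∀ k, τ (f k) ∈ S := by
  obtain ⟨τ, hτ⟩ := Equiv.Perm.exists_smul_eq_embedding f
    ((Fin.castLEEmb hS).trans (S.orderEmbOfFin rfl).toEmbedding)
  refine ⟨τ, fun k => ?_⟩
  have := DFunLike.congr_fun hτ k
  simp only [Function.Embedding.smul_apply, Equiv.Perm.smul_def] at this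
  rw [this]
  exact S.orderEmbOfFin_mem rfl _

/-- Coefficientwise action of a ring endomorphism of `ℂ`. -/
def twist (V : Type) [AddCommGroup V] [Module ℚ V] (g : ℂ →+* ℂ) : ℂ ⊗[ℚ] V →ₗ[ℚ] ℂ ⊗[ℚ] V :=
  TensorProduct.map g.toRatAlgHom.toLinearMap LinearMap.id

lemma twist_tmul (V : Type) [AddCommGroup V] [Module ℚ V] (g : ℂ →+* ℂ) (c : ℂ) (v : V) :
    twist V g (c ⊗ₜ v) = g c ⊗ₜ v := rfl

lemma twist_smul (V : Type) [AddCommGroup V] [Module ℚ V] (g : ℂ →+* ℂ) (c : ℂ) (x : ℂ ⊗[ℚ] V) :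
    twist V g (c • x) = g c • twist V g x := by
  induction x using TensorProduct.induction_on with
  | zero => simp
  | tmul a v => simp [twist_tmul, TensorProduct.smul_tmul']
  | add x y hx hy => rw [smul_add, map_add, hx, hy, map_add, smul_add]

lemma twist_baseChange (V : Type) [AddCommGroup V] [Module ℚ V] (g : ℂ →+* ℂ) (φ : V →ₗ[ℚ] V)
    (x : ℂ ⊗[ℚ] V) :
    twist V g (LinearMap.baseChange ℂ φ x) = LinearMap.baseChange ℂ φ (twist V g x) := by
  induction x using TensorProduct.induction_on with
  | zero => simp
  | tmul a v => simp [twist_tmul]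
  | add x y hx hy => rw [map_add, map_add, hx, hy, map_add, map_add]

lemma conjV_eq (V : Type) [AddCommGroup V] [Module ℚ V] :
    conjV V = twist V (starRingEnd ℂ) := by
  apply TensorProduct.ext'
  intro a v
  rfl

/-- The image of `W` under conjugation as a complex subspace. -/
def conjSubC (V : Type) [AddCommGroup V] [Module ℚ V] (W : Submodule ℂ (ℂ ⊗[ℚ] V)) :
    Submodule ℂ (ℂ ⊗[ℚ] V) where
  carrier := conjSub V W
  add_mem' := (conjSub V W).add_mem
  zero_mem' := (conjSub V W).zero_mem
  smul_mem' := by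
    rintro c _ ⟨x, hx, rfl⟩
    refine ⟨(starRingEnd ℂ c) • x, W.smul_mem _ hx, ?_⟩
    rw [conjV_eq, twist_smul]
    simp

lemma conjSubC_inv (V : Type) [AddCommGroup V] [Module ℚ V] (φ : V →ₗ[ℚ] V)
    (W : Submodule ℂ (ℂ ⊗[ℚ] V))
    (hWinv : ∀ x ∈ W, LinearMap.baseChange ℂ φ x ∈ W) :
    ∀ x ∈ conjSubC V W, LinearMap.baseChange ℂ φ x ∈ conjSubC V W := by
  rintro _ ⟨x, hx, rfl⟩
  refine ⟨_, hWinv x hx, ?_⟩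
  rw [conjV_eq, twist_baseChange]

lemma exists_eigenbasis (m : ℕ) (V : Type) [AddCommGroup V] [Module ℚ V] [FiniteDimensional ℚ V]
    (hdim : Module.finrank ℚ V = m) (φ : V →ₗ[ℚ] V)
    (lam : Fin m → ℂ) (hinj : Function.Injective lam)
    (hroot : ∀ i, Polynomial.aeval (lam i) (LinearMap.charpoly φ) = 0) :
    ∃ b : Module.Basis (Fin m) ℂ (ℂ ⊗[ℚ] V),
      ∀ i, LinearMap.baseChange ℂ φ (b i) = lam i • b i := by
  have hev : ∀ i, Module.End.HasEigenvalue (LinearMap.baseChange ℂ φ : Module.End ℂ (ℂ ⊗[ℚ] V))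
      (lam i) := by
    intro i
    rw [Module.End.hasEigenvalue_iff_isRoot_charpoly, LinearMap.charpoly_baseChange,
      Polynomial.IsRoot.def, Polynomial.eval_map_algebraMap]
    exact hroot i
  choose v hv using fun i => (hev i).exists_hasEigenvector
  have hli := Module.End.eigenvectors_linearIndependent' _ lam hinj v hv
  have hfr : Fintype.card (Fin m) = Module.finrank ℂ (ℂ ⊗[ℚ] V) := by
    rw [Module.finrank_baseChange, hdim, Fintype.card_fin]
  by_cases hm : m = 0
  · subst hm
    have : Subsingleton (ℂ ⊗[ℚ] V) := Module.finrank_zero_iff.1 (by rw [← hfr]; simp)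
    exact ⟨Module.Basis.empty _, fun i => i.elim0⟩
  have : Nonempty (Fin m) := ⟨⟨0, by omega⟩⟩
  refine ⟨basisOfLinearIndependentOfCardEqFinrank hli hfr, fun i => ?_⟩
  rw [coe_basisOfLinearIndependentOfCardEqFinrank]
  exact (hv i).apply_eq_smul

lemma eigen_line {X : Type} [AddCommGroup X] [Module ℂ X] {m : ℕ} (b : Module.Basis (Fin m) ℂ X)
    (Φ : X →ₗ[ℂ] X) (lam : Fin m → ℂ) (hinj : Function.Injective lam)
    (hb : ∀ i, Φ (b i) = lam i • b i) (i : Fin m) (x : X) (hx : Φ x = lam i • x) :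
    x = b.repr x i • b i := by
  have h1 : ∀ y j, b.repr (Φ y) j = lam j * b.repr y j := by
    intro y j
    have : b.coord j ∘ₗ Φ = lam j • b.coord j := by
      apply b.ext
      intro k
      simp only [LinearMap.comp_apply, hb, map_smul, LinearMap.smul_apply, Module.Basis.coord_apply,
        Module.Basis.repr_self, smul_eq_mul]
      by_cases hkj : k = j
      · subst hkj; rfl
      · simp [Finsupp.single_eq_of_ne (Ne.symm hkj)]
    exact LinearMap.congr_fun this y
  apply b.repr.injective
  ext j
  by_cases hj : j = i
  · subst hj; simp
  · have := h1 x j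
    rw [hx] at this
    simp only [map_smul, Finsupp.smul_apply, smul_eq_mul] at this
    have h0 : b.repr x j = 0 := by
      have h2 : (lam i - lam j) * b.repr x j = 0 := by linear_combination this
      rcases mul_eq_zero.1 h2 with h | h
      · exact absurd (hinj (sub_eq_zero.1 h)).symm hj
      · exact h
    simp [h0, Finsupp.single_eq_of_ne hj]

lemma mem_or_mem {X : Type} [AddCommGroup X] [Module ℂ X] {m : ℕ} (b : Module.Basis (Fin m) ℂ X)
    (Φ : X →ₗ[ℂ] X) (lam : Fin m → ℂ) (hinj : Function.Injective lam)
    (hb : ∀ i, Φ (b i) = lam i • b i) (W W' : Submodule ℂ X)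
    (hW : ∀ x ∈ W, Φ x ∈ W) (hW' : ∀ x ∈ W', Φ x ∈ W')
    (hsup : ∀ x, ∃ y ∈ W, ∃ z ∈ W', y + z = x) (hinf : ∀ x, x ∈ W → x ∈ W' → x = 0) (i : Fin m) :
    b i ∈ W ∨ b i ∈ W' := by
  obtain ⟨y, hy, z, hz, hyz⟩ := hsup (b i)
  have h1 : Φ y - lam i • y = -(Φ z - lam i • z) := by
    have := hb i
    rw [← hyz, map_add, smul_add] at this
    rw [eq_neg_iff_add_eq_zero, sub_add_sub_comm, this, sub_self]
  have h0 : Φ y - lam i • y = 0 := by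
    refine hinf _ (W.sub_mem (hW _ hy) (W.smul_mem _ hy)) ?_
    rw [h1]
    exact W'.neg_mem (W'.sub_mem (hW' _ hz) (W'.smul_mem _ hz))
  have h0' : Φ z - lam i • z = 0 := by rw [h0, eq_comm, neg_eq_zero] at h1; exact h1
  have ey := eigen_line b Φ lam hinj hb i y (sub_eq_zero.1 h0)
  have ez := eigen_line b Φ lam hinj hb i z (sub_eq_zero.1 h0')
  by_cases hy0 : b.repr y i = 0
  · right
    rw [hy0, zero_smul] at ey
    rw [← hyz, ey, zero_add]
    exact hz
  · left
    rw [ey] at hy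
    exact (W.smul_mem_iff hy0).1 hy

lemma scal_eq {X : Type} [AddCommGroup X] [Module ℂ X] {m : ℕ} (b : Module.Basis (Fin m) ℂ X)
    (W W' : Submodule ℂ X) (S : Finset (Fin m)) (hS : ∀ i ∈ S, b i ∈ W) (hS' : ∀ i ∉ S, b i ∈ W')
    (hinf : ∀ x, x ∈ W → x ∈ W' → x = 0) (x : X) (hx : x ∈ W) :
    ∑ i ∈ S, b.repr x i • b i = x := by
  classical
  have h := b.sum_repr x
  rw [← Finset.sum_add_sum_compl S] at h
  have h1 : ∑ i ∈ S, b.repr x i • b i ∈ W := W.sum_mem fun i hi => W.smul_mem _ (hS i hi)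
  have h2 : ∑ i ∈ Sᶜ, b.repr x i • b i ∈ W' :=
    W'.sum_mem fun i hi => W'.smul_mem _ (hS' i (Finset.mem_compl.1 hi))
  have h3 : ∑ i ∈ Sᶜ, b.repr x i • b i = 0 := by
    refine hinf _ ?_ h2
    rw [← eq_sub_iff_add_eq'] at h
    rw [h]
    exact W.sub_mem hx h1
  rw [h3, add_zero] at h
  exact h

lemma card_eq {X : Type} [AddCommGroup X] [Module ℂ X] {m : ℕ} (b : Module.Basis (Fin m) ℂ X)
    (W W' : Submodule ℂ X) (S : Finset (Fin m)) (hS : ∀ i ∈ S, b i ∈ W) (hS' : ∀ i ∉ S, b i ∈ W')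
    (hinf : ∀ x, x ∈ W → x ∈ W' → x = 0) : Module.finrank ℂ W = S.card := by
  have : W = Submodule.span ℂ (Set.range (fun i : S => b i)) := by
    apply le_antisymm
    · intro x hx
      rw [← scal_eq b W W' S hS hS' hinf x hx]
      exact Submodule.sum_mem _ fun i hi => Submodule.smul_mem _ _
        (Submodule.subset_span ⟨⟨i, hi⟩, rfl⟩)
    · rw [Submodule.span_le]
      rintro _ ⟨i, rfl⟩
      exact hS i i.2
  have h := finrank_span_eq_card (b := fun i : S => b i)
    (b.linearIndependent.comp _ Subtype.val_injective)
  rw [this, h]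
  simp

section theta
variable (V : Type) [AddCommGroup V] [Module ℚ V]
    [Algebra ℚ (ExteriorAlgebra ℂ (ℂ ⊗[ℚ] V))]
    [IsScalarTower ℚ ℂ (ExteriorAlgebra ℂ (ℂ ⊗[ℚ] V))]

lemma theta_ι (v : V) : thetaA V (ExteriorAlgebra.ι ℚ v) = ExteriorAlgebra.ι ℂ (1 ⊗ₜ v) := by
  exact ExteriorAlgebra.lift_ι_apply ℚ _ _ v

lemma theta_smul (a : ℚ) (x : ExteriorAlgebra ℚ V) :
    thetaA V (a • x) = (a : ℂ) • thetaA V x := by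
  rw [Algebra.smul_def, map_mul, AlgHom.commutes, Algebra.smul_def]
  congr 1
  exact RingHom.congr_fun (Subsingleton.elim (algebraMap ℚ _)
    ((algebraMap ℂ (ExteriorAlgebra ℂ (ℂ ⊗[ℚ] V))).comp (algebraMap ℚ ℂ))) a

lemma theta_multi (k : ℕ) (v : Fin k → V) : thetaA V (ExteriorAlgebra.ιMulti ℚ k v) =
    ExteriorAlgebra.ιMulti ℂ k (fun i => (1 : ℂ) ⊗ₜ[ℚ] v i) := by
  rw [ExteriorAlgebra.ιMulti_apply, ExteriorAlgebra.ιMulti_apply, map_list_prod, List.map_ofFn]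
  congr 2
  funext i
  exact theta_ι V _

lemma theta_fixed (s : ExteriorAlgebra ℂ (ℂ ⊗[ℚ] V) →+* ExteriorAlgebra ℂ (ℂ ⊗[ℚ] V))
    (g : ℂ →+* ℂ)
    (hs : ∀ x, s (ExteriorAlgebra.ι ℂ x) = ExteriorAlgebra.ι ℂ (twist V g x))
    (y : ExteriorAlgebra ℚ V) : s (thetaA V y) = thetaA V y := by
  induction y using ExteriorAlgebra.induction with
  | algebraMap r =>
    rw [AlgHom.commutes]
    exact RingHom.congr_fun (Subsingleton.elim (s.comp (algebraMap ℚ _)) (algebraMap ℚ _)) r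
  | ι x => rw [theta_ι, hs, twist_tmul, map_one]
  | mul a b ha hb => rw [map_mul, map_mul, ha, hb]
  | add a b ha hb => rw [map_add, map_add, ha, hb]

lemma theta_mem (y : ExteriorAlgebra ℚ V) (hy : y ∈ ⋀[ℚ]^4 V) :
    thetaA V y ∈ ⋀[ℂ]^4 (ℂ ⊗[ℚ] V) := by
  rw [← ExteriorAlgebra.ιMulti_span_fixedDegree] at hy
  induction hy using Submodule.span_induction with
  | mem x hx =>
    obtain ⟨v, rfl⟩ := hx
    rw [theta_multi]
    exact ExteriorAlgebra.ιMulti_range ℂ 4 ⟨_, rfl⟩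
  | zero => rw [map_zero]; exact Submodule.zero_mem _
  | add x y _ _ hx hy => rw [map_add]; exact Submodule.add_mem _ hx hy
  | smul a x _ hx =>
    rw [theta_smul]; exact Submodule.smul_mem _ _ hx

lemma theta_inj [FiniteDimensional ℚ V] (y : ExteriorAlgebra ℚ V) (hy : y ∈ ⋀[ℚ]^4 V)
    (h : thetaA V y = 0) : y = 0 := by
  classical
  let b := Module.finBasis ℚ V
  let b' : Module.Basis _ ℂ (ℂ ⊗[ℚ] V) := Algebra.TensorProduct.basis ℂ b
  rw [← exteriorPower.ιMulti_family_span_fixedDegree_of_span ℚ (n := 4) b.span_eq,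
    Submodule.mem_span_range_iff_exists_fun] at hy
  obtain ⟨c, rfl⟩ := hy
  have hli : LinearIndependent ℂ (ExteriorAlgebra.ιMulti_family ℂ 4 b') := by
    have := (exteriorPower.ιMulti_family_linearIndependent_ofBasis ℂ 4 b').map'
      (Submodule.subtype _) (Submodule.ker_subtype _)
    exact this
  rw [map_sum] at h
  have h2 : ∑ I, (c I : ℂ) • ExteriorAlgebra.ιMulti_family ℂ 4 b' I = 0 := by
    rw [← h]
    refine Finset.sum_congr rfl fun I _ => ?_
    rw [theta_smul, ExteriorAlgebra.ιMulti_family, ExteriorAlgebra.ιMulti_family, theta_multi]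
    congr 2
    funext k
    simp [b']
  have h3 := Fintype.linearIndependent_iff.1 hli _ h2
  refine Finset.sum_eq_zero fun I _ => ?_
  have : c I = 0 := by exact_mod_cast h3 I
  rw [this, zero_smul]

end theta

lemma scal_twist (V : Type) [AddCommGroup V] [Module ℚ V] {m : ℕ}
    (b : Module.Basis (Fin m) ℂ (ℂ ⊗[ℚ] V)) (g : ℂ →+* ℂ) (τ : Equiv.Perm (Fin m))
    (hτ : ∀ i, ∃ c : ℂ, twist V g (b i) = c • b (τ i))
    (d : Fin m → ℂ) (hd : ∀ i, g (d i) = d i) (x : ℂ ⊗[ℚ] V) :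
    twist V g (scal b (d ∘ τ) x) = scal b d (twist V g x) := by
  have h := b.sum_repr x
  rw [← h]
  simp only [map_sum, map_smul, scal_basis, twist_smul]
  refine Finset.sum_congr rfl fun i _ => ?_
  obtain ⟨c, hc⟩ := hτ i
  rw [hc, map_smul, scal_basis, Function.comp_apply, hd, smul_comm c]

lemma map_semilin (V : Type) [AddCommGroup V] [Module ℚ V]
    (s : ExteriorAlgebra ℂ (ℂ ⊗[ℚ] V) →+* ExteriorAlgebra ℂ (ℂ ⊗[ℚ] V))
    (g : ℂ →+* ℂ) (h1 : ∀ c, s (algebraMap ℂ _ c) = algebraMap ℂ _ (g c))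
    (h2 : ∀ x, s (ExteriorAlgebra.ι ℂ x) = ExteriorAlgebra.ι ℂ (twist V g x))
    (A B : (ℂ ⊗[ℚ] V) →ₗ[ℂ] (ℂ ⊗[ℚ] V)) (hAB : ∀ x, twist V g (A x) = B (twist V g x))
    (y : ExteriorAlgebra ℂ (ℂ ⊗[ℚ] V)) :
    s (ExteriorAlgebra.map A y) = ExteriorAlgebra.map B (s y) := by
  induction y using ExteriorAlgebra.induction with
  | algebraMap r => rw [AlgHom.commutes, h1, AlgHom.commutes]
  | ι x => rw [ExteriorAlgebra.map_apply_ι, h2, h2, ExteriorAlgebra.map_apply_ι, hAB]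
  | mul a b ha hb => simp only [map_mul, ha, hb]
  | add a b ha hb => simp only [map_add, ha, hb]

lemma hodge_scalar (V : Type) [AddCommGroup V] [Module ℚ V] (W : Submodule ℂ (ℂ ⊗[ℚ] V))
    (A : (ℂ ⊗[ℚ] V) →ₗ[ℂ] (ℂ ⊗[ℚ] V)) (hA : ∀ x ∈ W, A x = (2 : ℂ) • x)
    (hA' : ∀ x ∈ conjSub V W, A x = x) (p : ℕ) (x : ExteriorAlgebra ℂ (ℂ ⊗[ℚ] V))
    (hx : x ∈ hodgeComp V W 4 p) :
    ExteriorAlgebra.map A x = (∏ i : Fin 4, if (i : ℕ) < p then (2 : ℂ) else 1) • x := by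
  induction hx using Submodule.span_induction with
  | mem x hx =>
    obtain ⟨v, hv, rfl⟩ := hx
    apply scal_multi
    intro i
    split_ifs with h
    · exact hA _ ((hv i).1 h)
    · rw [one_smul]; exact hA' _ ((hv i).2 (not_lt.1 h))
  | zero => simp
  | add x y _ _ hx hy => rw [map_add, hx, hy, smul_add]
  | smul a x _ hx => rw [map_smul, hx, smul_comm]

/-- Under condition (*) (`n ≥ 4`), `⋀⁴V` contains no nonzero sub-Hodge
structure of Hodge level `≤ 2`: if `N ⊆ ⋀⁴V` is a `ℚ`-subspace such that `ℂ ⊗ N` is the direct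
sum (over `p + q = 4`) of its intersections with the `(p,q)`-components of `⋀⁴(ℂ ⊗ V)`, and
moreover `(ℂ ⊗ N) ∩ ⋀⁴W = 0` and `(ℂ ⊗ N) ∩ ⋀⁴c(W) = 0`, then `N = 0`. -/
theorem no_low_level_subHodge_structure_of_wedge_four
    (n : ℕ) (hn : 4 ≤ n)
    (V : Type) [AddCommGroup V] [Module ℚ V] [FiniteDimensional ℚ V]
    (hdim : Module.finrank ℚ V = 2 * n)
    (φ : V →ₗ[ℚ] V)
    (lam : Fin (2 * n) → ℂ) (hinj : Function.Injective lam)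
    (hroot : ∀ i, Polynomial.aeval (lam i) (LinearMap.charpoly φ) = 0)
    (hgal : galoisActsFully (2 * n) lam)
    (W : Submodule ℂ (ℂ ⊗[ℚ] V))
    (hWdim : Module.finrank ℂ W = n)
    (hWinv : ∀ x ∈ W, LinearMap.baseChange ℂ φ x ∈ W)
    (hWsup : W.restrictScalars ℚ ⊔ conjSub V W = ⊤)
    (hWinf : W.restrictScalars ℚ ⊓ conjSub V W = ⊥)
    [Algebra ℚ (ExteriorAlgebra ℂ (ℂ ⊗[ℚ] V))]
    [IsScalarTower ℚ ℂ (ExteriorAlgebra ℂ (ℂ ⊗[ℚ] V))]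
    (N : Submodule ℚ (ExteriorAlgebra ℚ V)) (hN : N ≤ ⋀[ℚ]^4 V)
    (hNdecomp : Submodule.span ℂ (⇑(thetaA V) '' N) =
      ⨆ p : Fin 5, (Submodule.span ℂ (⇑(thetaA V) '' N) ⊓ hodgeComp V W 4 p))
    (hN40 : Submodule.span ℂ (⇑(thetaA V) '' N) ⊓ hodgeComp V W 4 4 = ⊥)
    (hN04 : Submodule.span ℂ (⇑(thetaA V) '' N) ⊓ hodgeComp V W 4 0 = ⊥) :
    N = ⊥ := by
  classical
  set M := Submodule.span ℂ (⇑(thetaA V) '' N) with hMdef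
  by_cases hM0 : M = ⊥
  · rw [Submodule.eq_bot_iff]
    intro y hy
    refine theta_inj V y (hN hy) ?_
    have : thetaA V y ∈ M := Submodule.subset_span ⟨y, hy, rfl⟩
    rw [hM0] at this
    exact (Submodule.mem_bot ℂ).1 this
  exfalso
  have hM4 : M ≤ ⋀[ℂ]^4 (ℂ ⊗[ℚ] V) := by
    rw [hMdef, Submodule.span_le]
    rintro _ ⟨y, hy, rfl⟩
    exact theta_mem V y (hN hy)
  obtain ⟨b, hb⟩ := exists_eigenbasis (2 * n) V hdim φ lam hinj hroot
  have hinf : ∀ x, x ∈ W → x ∈ conjSubC V W → x = 0 := by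
    intro x h1 h2
    have : x ∈ W.restrictScalars ℚ ⊓ conjSub V W := ⟨h1, h2⟩
    rw [hWinf] at this
    exact (Submodule.mem_bot ℚ).1 this
  have hsup : ∀ x, ∃ y ∈ W, ∃ z ∈ conjSubC V W, y + z = x := by
    intro x
    have : x ∈ W.restrictScalars ℚ ⊔ conjSub V W := by rw [hWsup]; trivial
    obtain ⟨y, hy, z, hz, h⟩ := Submodule.mem_sup.1 this
    exact ⟨y, hy, z, hz, h⟩
  let S : Finset (Fin (2 * n)) := Finset.univ.filter fun i => b i ∈ W
  have hS : ∀ i ∈ S, b i ∈ W := fun i hi => (Finset.mem_filter.1 hi).2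
  have hS' : ∀ i ∉ S, b i ∈ conjSubC V W := by
    intro i hi
    rcases mem_or_mem b _ lam hinj hb W (conjSubC V W) hWinv (conjSubC_inv V φ W hWinv) hsup
      hinf i with h | h
    · have hi2 : i ∈ S := by simp [S, h]
      exact absurd hi2 hi
    · exact h
  have hcard : S.card = n := (card_eq b W (conjSubC V W) S hS hS' hinf).symm.trans hWdim
  let d : Fin (2 * n) → ℂ := fun i => if i ∈ S then 2 else 1
  have hd : ∀ i, d i = 1 ∨ d i = 2 := by
    intro i
    by_cases h : i ∈ S <;> simp [d, h]
  obtain ⟨a, ha⟩ : S.Nonempty := by rw [← Finset.card_pos]; omega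
  obtain ⟨c, hc⟩ : Sᶜ.Nonempty := by
    rw [← Finset.card_pos, Finset.card_compl, hcard, Fintype.card_fin]; omega
  have hA : ∀ x ∈ W, scal b d x = (2 : ℂ) • x := by
    intro x hx
    rw [← scal_eq b W (conjSubC V W) S hS hS' hinf x hx, map_sum, Finset.smul_sum]
    refine Finset.sum_congr rfl fun i hi => ?_
    rw [map_smul, scal_basis, smul_comm]
    simp [d, hi]
  have hA' : ∀ x ∈ conjSub V W, scal b d x = x := by
    intro x hx
    have h := scal_eq b (conjSubC V W) W Sᶜ (fun i hi => hS' i (Finset.mem_compl.1 hi))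
      (fun i hi => hS i (by simpa using hi)) (fun x h1 h2 => hinf x h2 h1) x hx
    rw [← h, map_sum]
    refine Finset.sum_congr rfl fun i hi => ?_
    rw [map_smul, scal_basis]
    simp [d, Finset.mem_compl.1 hi]
  have hstab0 : ∀ x ∈ M, ExteriorAlgebra.map (scal b d) x ∈ M := by
    intro x hx
    rw [hNdecomp] at hx
    induction hx using Submodule.iSup_induction' with
    | mem p x hx =>
      rw [hodge_scalar V W _ hA hA' p x hx.2]
      exact M.smul_mem _ hx.1
    | zero => rw [map_zero]; exact M.zero_mem
    | add x y _ _ hx hy => rw [map_add]; exact M.add_mem hx hy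
  have hgalC : ∀ τ : Equiv.Perm (Fin (2 * n)),
      ∃ (g : ℂ →+* ℂ) (s : ExteriorAlgebra ℂ (ℂ ⊗[ℚ] V) →+* ExteriorAlgebra ℂ (ℂ ⊗[ℚ] V)),
      (∀ c, s (algebraMap ℂ _ c) = algebraMap ℂ _ (g c)) ∧
      (∀ x, s (ExteriorAlgebra.ι ℂ x) = ExteriorAlgebra.ι ℂ (twist V g x)) ∧
      (∀ (k : ℕ) (v : Fin k → ℂ ⊗[ℚ] V), s (ExteriorAlgebra.ιMulti ℂ k v) =
        ExteriorAlgebra.ιMulti ℂ k (twist V g ∘ v)) ∧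
      (∀ x ∈ M, s x ∈ M) ∧ (∀ y, s (thetaA V y) = thetaA V y) ∧
      ∀ i, ∃ c : ℂ, c ≠ 0 ∧ twist V g (b i) = c • b (τ i) := by
    intro τ
    obtain ⟨σ, hσ⟩ := hgal τ
    obtain ⟨g, hg⟩ := exists_extend_aut _ σ
    obtain ⟨s, h1, h2, h3, h4⟩ := exists_semilin (X := ℂ ⊗[ℚ] V) (g : ℂ →+* ℂ)
      (twist V (g : ℂ →+* ℂ)).toAddMonoidHom (twist_smul V _)
    have hfix := theta_fixed V s (g : ℂ →+* ℂ) h2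
    refine ⟨(g : ℂ →+* ℂ), s, h1, h2, h4, ?_, hfix, ?_⟩
    · intro x hx
      induction hx using Submodule.span_induction with
      | mem x hx =>
        obtain ⟨y, hy, rfl⟩ := hx
        rw [hfix]
        exact Submodule.subset_span ⟨y, hy, rfl⟩
      | zero => rw [map_zero]; exact M.zero_mem
      | add x y _ _ hx hy => rw [map_add]; exact M.add_mem hx hy
      | smul a x _ hx => rw [h3]; exact M.smul_mem _ hx
    · intro i
      have e1 : LinearMap.baseChange ℂ φ (twist V (g : ℂ →+* ℂ) (b i)) =
          lam (τ i) • twist V (g : ℂ →+* ℂ) (b i) := by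
        rw [← twist_baseChange, hb, twist_smul]
        congr 1
        rw [← hσ i]
        exact hg ⟨lam i, root_mem_splittingFieldOfRoots _ lam i⟩
      have e2 := eigen_line b _ lam hinj hb (τ i) _ e1
      refine ⟨_, ?_, e2⟩
      intro h0
      rw [h0, zero_smul] at e2
      have e3 : twist V (g.symm : ℂ →+* ℂ) (twist V (g : ℂ →+* ℂ) (b i)) = b i := by
        generalize b i = x
        induction x using TensorProduct.induction_on with
        | zero => simp
        | tmul a v => simp [twist_tmul]
        | add x y hx hy => rw [map_add, map_add, hx, hy]
      rw [e2, map_zero] at e3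
      exact b.ne_zero i e3.symm
  have hstab : ∀ τ : Equiv.Perm (Fin (2 * n)), ∀ x ∈ M,
      ExteriorAlgebra.map (scal b (d ∘ τ)) x ∈ M := by
    intro τ x hx
    obtain ⟨g, s, h1, h2, h4, hsM, hfix, hbτ⟩ := hgalC τ⁻¹
    induction hx using Submodule.span_induction with
    | mem x hx =>
      obtain ⟨y, hy, rfl⟩ := hx
      rw [← hfix y, ← map_semilin V s g h1 h2 (scal b d)]
      · exact hsM _ (hstab0 _ (Submodule.subset_span ⟨y, hy, rfl⟩))
      · intro x
        have := scal_twist V b g τ⁻¹ (fun i => (hbτ i).imp fun _ h => h.2) (d ∘ τ) (by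
          intro i
          rcases hd (τ i) with h | h
          · simp [h]
          · simp only [Function.comp_apply, h]; exact map_ofNat g 2) x
        rw [← this]
        congr 3
        funext i
        simp
    | zero => rw [map_zero]; exact M.zero_mem
    | add x y _ _ hx hy => rw [map_add]; exact M.add_mem hx hy
    | smul a x _ hx => rw [map_smul]; exact M.smul_mem _ hx
  obtain ⟨f, hf⟩ := core b M hM4 hM0 d hd a (by simp [d, ha]) c
    (by simp [d, Finset.mem_compl.1 hc]) hstab
  obtain ⟨τ, hτ⟩ := exists_perm_into S (by omega) f
  obtain ⟨g, s, h1, h2, h4, hsM, hfix, hbτ⟩ := hgalC τ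
  have hmem := hsM _ hf
  choose cc hcc0 hcc using hbτ
  rw [h4] at hmem
  have heq : ⇑(twist V g) ∘ ⇑b ∘ ⇑f = fun k => cc (f k) • (b ∘ (f.trans τ.toEmbedding)) k := by
    funext k
    exact hcc (f k)
  rw [heq, AlternatingMap.map_smul_univ,
    M.smul_mem_iff (Finset.prod_ne_zero_iff.2 fun k _ => hcc0 (f k))] at hmem
  have hz : ExteriorAlgebra.ιMulti ℂ 4 (b ∘ (f.trans τ.toEmbedding)) ∈
      M ⊓ hodgeComp V W 4 4 := by
    refine ⟨hmem, Submodule.subset_span ⟨_, fun i => ⟨fun _ => hS _ (hτ i), fun h => ?_⟩, rfl⟩⟩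
    have := i.2
    omega
  rw [hN40] at hz
  exact iMulti_ne_zero b _ ((Submodule.mem_bot ℂ).1 hz)

end VoisinPaper
end
end
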